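/- arXiv:1312.7094 — 7 statements merged into one kernel-verified Lean document; each statement's English description precedes it below -/
import Mathlib

section
/- Let S be a commutative semiring, let n ≥ 1, let A = (a_{ij}) be an n×n matrix over S, and let w be the rooted spanning tree (RST) vector of A. Then for each i = 1, …, n, the balance equation holds: w_i · (Σ_{j ≠ i} a_{ij}) = Σ_{j ≠ i} w_j · a_{ji}. -/
open scoped Classical

section FunctionalDigraph

variable {V : Type*}

/-- Every point of `V` reaches `r` under iteration of `f`. -/
def IsGloballyReached (f : V → V) (r : V) : Prop :=
  ∀ j, ∃ m : ℕ, f^[m] j = r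

theorem IsGloballyReached.of_eqOn_compl {f g : V → V} {r : V} (h : IsGloballyReached f r)
    (hfg : ∀ j, j ≠ r → f j = g j) : IsGloballyReached g r := by
  intro j
  obtain ⟨m, hm⟩ := h j
  induction m generalizing j with
  | zero => exact ⟨0, hm⟩
  | succ m ih =>
    by_cases hj : j = r
    · exact ⟨0, hj⟩
    · obtain ⟨k, hk⟩ := ih (f j) hm
      exact ⟨k + 1, by rw [Function.iterate_succ_apply, ← hfg j hj, hk]⟩

theorem IsGloballyReached.update [DecidableEq V] {f : V → V} {r : V}
    (h : IsGloballyReached f r) (k : V) : IsGloballyReached (Function.update f r k) r :=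
  h.of_eqOn_compl fun _ hj => (Function.update_of_ne hj _ _).symm

theorem IsGloballyReached.trans {f : V → V} {r s : V} (h : IsGloballyReached f r) {m : ℕ}
    (hm : f^[m] r = s) : IsGloballyReached f s := by
  intro j
  obtain ⟨k, hk⟩ := h j
  exact ⟨m + k, by rw [Function.iterate_add_apply, hk, hm]⟩

theorem IsGloballyReached.apply_ne {f : V → V} {r s : V} (h : IsGloballyReached f r)
    (hs : s ≠ r) : f s ≠ s := by
  intro hfs
  obtain ⟨m, hm⟩ := h s
  exact hs ((Function.iterate_fixed hfs m).symm.trans hm)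

theorem IsGloballyReached.mem_periodicPts {f : V → V} {r : V} (h : IsGloballyReached f r) :
    r ∈ Function.periodicPts f := by
  obtain ⟨m, hm⟩ := h (f r)
  exact ⟨m + 1, m.succ_pos, hm⟩

theorem IsGloballyReached.eq_of_apply_eq {f : V → V} {r s : V} (hr : IsGloballyReached f r)
    (hs : IsGloballyReached f s) (hrs : f r = f s) : r = s :=
  (Function.bijOn_periodicPts f).injOn hr.mem_periodicPts hs.mem_periodicPts hrs

theorem IsGloballyReached.exists_apply_eq {f : V → V} {r : V} (h : IsGloballyReached f r) :
    ∃ s, f s = r ∧ IsGloballyReached f s := by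
  obtain ⟨m, hm⟩ := h (f r)
  refine ⟨f^[m] r, ?_, h.trans rfl⟩
  rw [← Function.iterate_succ_apply' f, Function.iterate_succ_apply, hm]

variable [Fintype V] [DecidableEq V] {S : Type*} [CommSemiring S]

theorem prod_update_edge (a : V → V → S) (f : V → V) (r k : V) :
    ∏ j, a j (Function.update f r k j) =
      (∏ j ∈ Finset.univ.filter (fun j => j ≠ r), a j (f j)) * a r k := by
  rw [← Finset.prod_filter_mul_prod_filter_not Finset.univ (fun j => j ≠ r)]
  congr 1
  · refine Finset.prod_congr rfl fun j hj => ?_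
    rw [Function.update_of_ne (Finset.mem_filter.mp hj).2]
  · simp [Finset.filter_eq']

/-- Adding the edge `(i, k)` to spanning `i`-trees enumerates the maps with a unique cycle,
of length at least two and through `i`. -/
theorem sum_tree_mul_out_edge (a : V → V → S) (i : V) :
    (∑ f ∈ Finset.univ.filter (fun f : V → V => f i = i ∧ IsGloballyReached f i),
        ∏ j ∈ Finset.univ.filter (fun j => j ≠ i), a j (f j)) *
      (∑ k ∈ Finset.univ.filter (fun k => k ≠ i), a i k) =
    ∑ g ∈ Finset.univ.filter (fun g : V → V => g i ≠ i ∧ IsGloballyReached g i),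
      ∏ j, a j (g j) := by
  rw [Finset.sum_mul_sum, ← Finset.sum_product']
  refine Finset.sum_bij' (fun p _ => Function.update p.1 i p.2)
    (fun g _ => (Function.update g i i, g i)) ?_ ?_ ?_ ?_ ?_
  · rintro ⟨f, k⟩ h
    simp only [Finset.mem_product, Finset.mem_filter_univ] at h ⊢
    exact ⟨by simpa using h.2, h.1.2.update k⟩
  · intro g h
    simp only [Finset.mem_product, Finset.mem_filter_univ] at h ⊢
    exact ⟨⟨by simp, h.2.update i⟩, h.1⟩
  · rintro ⟨f, k⟩ h
    simp only [Finset.mem_product, Finset.mem_filter_univ] at h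
    have := Function.update_eq_self i f
    simp_all
  · intro g h
    simp
  · rintro ⟨f, k⟩ h
    exact (prod_update_edge a f i k).symm

/-- Adding the edge `(j, i)` to spanning `j`-trees, `j ≠ i`, enumerates the maps with a unique
cycle, of length at least two and through `i`. -/
theorem sum_tree_mul_in_edge (a : V → V → S) (i : V) :
    ∑ j ∈ Finset.univ.filter (fun j => j ≠ i),
      (∑ f ∈ Finset.univ.filter (fun f : V → V => f j = j ∧ IsGloballyReached f j),
        ∏ k ∈ Finset.univ.filter (fun k => k ≠ j), a k (f k)) * a j i =
    ∑ g ∈ Finset.univ.filter (fun g : V → V => g i ≠ i ∧ IsGloballyReached g i),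
      ∏ j, a j (g j) := by
  simp_rw [Finset.sum_mul]
  rw [Finset.sum_sigma']
  refine Finset.sum_bij (fun p _ => Function.update p.2 p.1 i) ?_ ?_ ?_ ?_
  · rintro ⟨j, f⟩ h
    simp only [Finset.mem_sigma, Finset.mem_filter_univ] at h ⊢
    obtain ⟨hj, -, hf⟩ := h
    refine ⟨(hf.update i).apply_ne hj.symm, (hf.update i).trans (m := 1) (by simp)⟩
  · rintro ⟨j, f⟩ h ⟨j', f'⟩ h' heq
    simp only [Finset.mem_sigma, Finset.mem_filter_univ] at h h' heq
    obtain ⟨-, hfj, hf⟩ := h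
    obtain ⟨-, hfj', hf'⟩ := h'
    have hg' := hf'.update i
    rw [← heq] at hg'
    have hjj : j = j' := (hf.update i).eq_of_apply_eq hg' (by
      conv_rhs => rw [heq]
      simp)
    subst hjj
    have := congrArg (fun g => Function.update g j j) heq
    simp only [Function.update_idem] at this
    rw [Function.update_eq_self_iff.mpr hfj.symm, Function.update_eq_self_iff.mpr hfj'.symm] at this
    rw [this]
  · intro g h
    obtain ⟨hgi, hg⟩ := (Finset.mem_filter_univ _).mp h
    obtain ⟨j, hji, hj⟩ := hg.exists_apply_eq
    refine ⟨⟨j, Function.update g j j⟩, ?_, ?_⟩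
    · simp only [Finset.mem_sigma, Finset.mem_filter_univ]
      exact ⟨fun e => hgi (e ▸ hji), by simp, hj.update j⟩
    · simp [← hji]
  · rintro ⟨j, f⟩ h
    exact (prod_update_edge a f j i).symm

end FunctionalDigraph

/-- **Balance equation from the Markov Chain Tree Theorem in commutative semirings.**
Vertices are `Fin n` (vertex `i` stands for state `i+1`).  A spanning `i`-tree is
encoded by `f : Fin n → Fin n` with `f i = i` and every vertex reaching `i` under
iteration; its weight is the product of `a j (f j)` over `j ≠ i`.  The rooted
spanning tree vector `w` has entries the sums of these weights.  Then
`w i * (∑_{j ≠ i} a i j) = ∑_{j ≠ i} w j * a j i`. -/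
theorem stmt_0 {S : Type*} [CommSemiring S] {n : ℕ} (hn : 1 ≤ n)
    (a : Fin n → Fin n → S) (w : Fin n → S)
    (hw : ∀ i : Fin n, w i =
      ∑ f ∈ Finset.univ.filter
          (fun f : Fin n → Fin n => f i = i ∧ ∀ j : Fin n, ∃ m : ℕ, f^[m] j = i),
        ∏ j ∈ Finset.univ.filter (fun j : Fin n => j ≠ i), a j (f j)) :
    ∀ i : Fin n,
      w i * (∑ j ∈ Finset.univ.filter (fun j : Fin n => j ≠ i), a i j) =
        ∑ j ∈ Finset.univ.filter (fun j : Fin n => j ≠ i), w j * a j i := by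
  intro i
  simp only [hw]
  convert (sum_tree_mul_out_edge a i).trans (sum_tree_mul_in_edge a i).symm <;> exact Iff.rfl
end

section
/- Let S be a commutative semiring, let n ≥ 1, let A = (a_{ij}) be an n×n matrix over S, and fix i ∈ {1,…,n}. Then the total weight of all i-unicyclic functional digraphs equals w_i · (Σ_{j ≠ i} a_{ij}), where w is the rooted spanning tree vector of A; that is, Σ_{g i-unicyclic} Π_{j=1}^n a_{j, g(j)} = w_i · Σ_{j ≠ i} a_{ij}. -/
open scoped Classical

/-- Reachability of `i` depends only on the values of the map away from `i`. -/
theorem exists_iterate_eq_of_eqOn_compl {α : Type*} {f g : α → α} {i : α}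
    (hfg : ∀ j, j ≠ i → f j = g j) (m : ℕ) (j : α) (hm : f^[m] j = i) :
    ∃ k : ℕ, g^[k] j = i := by
  induction m generalizing j with
  | zero => exact ⟨0, hm⟩
  | succ m ih =>
    by_cases hj : j = i
    · exact ⟨0, hj⟩
    · obtain ⟨k, hk⟩ := ih (f j) hm
      exact ⟨k + 1, by rwa [Function.iterate_succ_apply, ← hfg j hj]⟩

/-- The total weight of all `i`-unicyclic functional digraphs (functions
`g : Fin n → Fin n` with `g i ≠ i` and every vertex reaching `i` in at least one
step; weight `∏ j, a j (g j)`) equals `w i * (∑_{j ≠ i} a i j)`, where `w` is the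
rooted spanning tree vector of `A`. -/
theorem stmt_2 {S : Type*} [CommSemiring S] {n : ℕ} (hn : 1 ≤ n)
    (a : Fin n → Fin n → S) (i : Fin n)
    (w : Fin n → S)
    (hw : ∀ i : Fin n, w i =
      ∑ f ∈ Finset.univ.filter
          (fun f : Fin n → Fin n => f i = i ∧ ∀ j : Fin n, ∃ m : ℕ, f^[m] j = i),
        ∏ j ∈ Finset.univ.filter (fun j : Fin n => j ≠ i), a j (f j)) :
    ∑ g ∈ Finset.univ.filter
        (fun g : Fin n → Fin n => g i ≠ i ∧ ∀ j : Fin n, ∃ m : ℕ, 1 ≤ m ∧ g^[m] j = i),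
      ∏ j : Fin n, a j (g j) =
    w i * (∑ j ∈ Finset.univ.filter (fun j : Fin n => j ≠ i), a i j) := by
  rw [hw i, Finset.sum_mul_sum, ← Finset.sum_product']
  refine Finset.sum_bij' (fun g _ => (Function.update g i i, g i))
    (fun p _ => Function.update p.1 i p.2) ?_ ?_ ?_ ?_ ?_
  · intro g hg
    simp only [Finset.mem_filter, Finset.mem_univ, true_and, Finset.mem_product] at hg ⊢
    refine ⟨⟨Function.update_self .., fun j => ?_⟩, hg.1⟩
    obtain ⟨m, -, hm⟩ := hg.2 j
    exact exists_iterate_eq_of_eqOn_compl (i := i)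
      (fun j hj => (Function.update_of_ne hj i g).symm) m j hm
  · rintro ⟨f, k⟩ hp
    simp only [Finset.mem_filter, Finset.mem_univ, true_and, Finset.mem_product] at hp ⊢
    refine ⟨by simpa using hp.2, fun j => ?_⟩
    obtain ⟨m, hm⟩ := hp.1.2 (Function.update f i k j)
    obtain ⟨l, hl⟩ := exists_iterate_eq_of_eqOn_compl (i := i)
      (fun j hj => (Function.update_of_ne hj k f).symm) m _ hm
    exact ⟨l + 1, Nat.le_add_left 1 l, hl⟩
  · intro g _
    simp
  · rintro ⟨f, k⟩ hp
    simp only [Finset.mem_filter, Finset.mem_univ, true_and, Finset.mem_product] at hp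
    simp [Function.update_eq_self_iff, hp.1.1]
  · intro g _
    rw [Finset.filter_ne', ← Finset.prod_erase_mul _ _ (Finset.mem_univ i)]
    congr 1
    refine Finset.prod_congr rfl fun j hj => ?_
    dsimp only
    rw [Function.update_of_ne (Finset.ne_of_mem_erase hj)]
end

section
/- Let S be a commutative semifield, let n ≥ 2, and let A = (a_{ij}) be an n×n matrix over S with s_1 := Σ_{j=2}^n a_{1j} ≠ 0. Let A^{(1)} be the reduced matrix on the index set {2,…,n} with entries a^{(1)}_{kl} = a_{kl} + a_{k1}·s_1^{-1}·a_{1l}. Then for every k with 2 ≤ k ≤ n, s_1 · w^{(1)}_k = w_k, where w is the rooted spanning tree vector of A and w^{(1)} is the rooted spanning tree vector of A^{(1)}. -/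
open scoped Classical

namespace SpanningTree

/-- `Reach f j r`: the vertex `r` is an iterate of `j` under `f`. -/
def Reach {V : Type*} (f : V → V) (j r : V) : Prop := ∃ m : ℕ, f^[m] j = r

section Reach

variable {V : Type*} {f : V → V} {j r r' : V}

theorem Reach.refl (f : V → V) (j : V) : Reach f j j := ⟨0, rfl⟩

theorem Reach.step (h : Reach f (f j) r) : Reach f j r := by
  obtain ⟨m, hm⟩ := h
  exact ⟨m + 1, hm⟩

theorem Reach.head_induction {P : V → Prop} (h : Reach f j r) (base : P r)
    (step : ∀ i, i ≠ r → P (f i) → P i) : P j := by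
  obtain ⟨m, hm⟩ := h
  induction m generalizing j with
  | zero =>
    obtain rfl : j = r := hm
    exact base
  | succ m ih =>
    by_cases hj : j = r
    · exact hj ▸ base
    · exact step j hj (ih hm)

theorem Reach.eq_of_fixed (h : Reach f j r) (hj : f j = j) : j = r := by
  obtain ⟨m, hm⟩ := h
  rwa [Function.iterate_fixed hj] at hm

theorem Reach.apply (h : Reach f j r) (hr : f r = r) : Reach f (f j) r := by
  obtain ⟨m, hm⟩ := h
  exact ⟨m, by rw [← Function.iterate_succ_apply, Function.iterate_succ_apply', hm, hr]⟩

theorem Reach.unique (h : Reach f j r) (h' : Reach f j r') (hr : f r = r)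
    (hr' : f r' = r') :
    r = r' := by
  have key : Reach f j r' → r = r' :=
    h.head_induction (P := fun i => Reach f i r' → r = r') (fun h => h.eq_of_fixed hr)
      fun i _ ih hi => ih (hi.apply hr')
  exact key h'

/-- Reachability after redirecting a fixed point `t` to `v`. -/
theorem reach_update_iff [DecidableEq V] {t v : V} (ht : f t = t) (hrt : r ≠ t) :
    Reach (Function.update f t v) j r ↔ Reach f j r ∨ (Reach f j t ∧ Reach f v r) := by
  have aux : ∀ i, Reach f i r → Reach (Function.update f t v) i r := by
    intro i hi
    obtain ⟨m, hm⟩ := hi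
    induction m generalizing i with
    | zero => exact ⟨0, hm⟩
    | succ m ih =>
      have hit : i ≠ t := by
        rintro rfl
        exact hrt (Reach.eq_of_fixed ⟨_, hm⟩ ht).symm
      apply Reach.step
      rw [Function.update_of_ne hit]
      exact ih _ hm
  constructor
  · intro h
    refine h.head_induction (P := fun i => Reach f i r ∨ (Reach f i t ∧ Reach f v r))
      (Or.inl (Reach.refl _ _)) ?_
    intro i _ ih
    by_cases hit : i = t
    · subst hit
      rw [Function.update_self] at ih
      exact Or.inr ⟨Reach.refl _ _, ih.elim id And.right⟩
    · rw [Function.update_of_ne hit] at ih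
      exact ih.imp Reach.step (And.imp_left Reach.step)
  · rintro (h | ⟨h, hv⟩)
    · exact aux j h
    · refine h.head_induction (P := fun i => Reach (Function.update f t v) i r) ?_ ?_
      · apply Reach.step
        rw [Function.update_self]
        exact aux v hv
      · intro i hit ih
        apply Reach.step
        rwa [Function.update_of_ne hit]

/-- Redirecting a root `t` of a forest to `v` leaves a forest exactly when `v` does not lie in the
tree of `t`. -/
theorem forest_update_iff [DecidableEq V] {U : Set V} {T : Finset V} {k t v : V} (hk : f k = k)
    (hT : ∀ i ∈ T, f i = i) (ht : f t = t) (htT : t ∉ T) (hkt : k ≠ t) (htU : t ∈ U)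
    (hv : v ∈ U) :
    (∀ j ∈ U, ∃ r ∈ insert k T, Reach (Function.update f t v) j r) ↔
      (∀ j ∈ U, ∃ r ∈ insert k (insert t T), Reach f j r) ∧ ¬ Reach f v t := by
  have hfix : ∀ r ∈ insert k T, f r = r ∧ r ≠ t := by
    intro r hr
    rcases Finset.mem_insert.1 hr with rfl | hr
    · exact ⟨hk, hkt⟩
    · exact ⟨hT r hr, fun h => htT (h ▸ hr)⟩
  have hsub : ∀ r ∈ insert k T, r ∈ insert k (insert t T) := by
    intro r hr
    simp only [Finset.mem_insert] at hr ⊢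
    tauto
  constructor
  · intro h
    refine ⟨fun j hj => ?_, fun hvt => ?_⟩
    · obtain ⟨r, hr, hjr⟩ := h j hj
      rcases (reach_update_iff ht (hfix r hr).2).1 hjr with h1 | h1
      · exact ⟨r, hsub r hr, h1⟩
      · exact ⟨t, by simp, h1.1⟩
    · obtain ⟨r, hr, hjr⟩ := h t htU
      rcases (reach_update_iff ht (hfix r hr).2).1 hjr with h1 | h1
      · exact (hfix r hr).2 (h1.eq_of_fixed ht).symm
      · exact (hfix r hr).2 (h1.2.unique hvt (hfix r hr).1 ht)
  · rintro ⟨h, hvt⟩ j hj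
    have hcase : ∀ i ∈ U, Reach f i t ∨ ∃ r ∈ insert k T, Reach f i r := by
      intro i hi
      obtain ⟨r, hr, hir⟩ := h i hi
      by_cases hrt : r = t
      · exact Or.inl (hrt ▸ hir)
      · refine Or.inr ⟨r, ?_, hir⟩
        simp only [Finset.mem_insert] at hr ⊢
        tauto
    rcases hcase j hj with h1 | ⟨r, hr, h1⟩
    · obtain ⟨r, hr, h2⟩ := (hcase v hv).resolve_left hvt
      exact ⟨r, hr, (reach_update_iff ht (hfix r hr).2).2 (Or.inr ⟨h1, h2⟩)⟩
    · exact ⟨r, hr, (reach_update_iff ht (hfix r hr).2).2 (Or.inl h1)⟩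

end Reach

/-- Weighted count of the ways to complete a forest `F` with roots `T ∪ {k}` to a spanning
`k`-tree, where redirecting a root to `v` has weight `c v`. -/
theorem sum_forest_completions {S V : Type*} [CommSemiring S] [Fintype V] [DecidableEq V]
    (U : Set V) (c : V → S) (hc : ∀ v, v ∉ U → c v = 0) (k : V) (T : Finset V) (hkT : k ∉ T) (hTU : ∀ t ∈ T, t ∈ U)
    (F : V → V) (hFk : F k = k) (hFT : ∀ t ∈ T, F t = t) :
    (∑ v, c v) * ∑ g ∈ Finset.univ.filter
        (fun g : V → V => (∀ j, j ∉ T → g j = F j) ∧ ∀ j ∈ U, Reach g j k), ∏ t ∈ T, c (g t) =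
      (∑ v, c v) ^ T.card * if ∀ j ∈ U, ∃ r ∈ insert k T, Reach F j r then
        ∑ p ∈ Finset.univ.filter (fun p => Reach F p k), c p else 0 := by
  induction T using Finset.induction_on generalizing F with
  | empty =>
    by_cases h : ∀ j ∈ U, Reach F j k
    · have h1 : Finset.univ.filter (fun g : V → V => (∀ j, j ∉ (∅ : Finset V) → g j = F j) ∧
          ∀ j ∈ U, Reach g j k) = {F} := by
        ext g
        simp only [Finset.mem_filter, Finset.mem_univ, true_and, Finset.mem_singleton]
        constructor
        · exact fun hg => funext fun j => hg.1 j (by simp)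
        · rintro rfl
          exact ⟨fun _ _ => rfl, h⟩
      have h2 : ∑ v, c v = ∑ p ∈ Finset.univ.filter (fun p => Reach F p k), c p := by
        rw [Finset.sum_filter]
        refine Finset.sum_congr rfl fun v _ => ?_
        split_ifs with hv
        · rfl
        · exact hc v fun hU => hv (h v hU)
      rw [h1, if_pos (by simpa using h)]
      simp [← h2]
    · rw [if_neg (by simpa using h), mul_zero]
      refine mul_eq_zero_of_right _ (Finset.sum_eq_zero fun g hg => ?_)
      have hg' := (Finset.mem_filter.1 hg).2
      obtain rfl : g = F := funext fun j => hg'.1 j (by simp)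
      exact absurd hg'.2 h
  | insert t T htT ih =>
    have hkt : k ≠ t := fun h => hkT (by simp [h])
    have ht : F t = t := hFT t (by simp)
    have htU : t ∈ U := hTU t (by simp)
    have hFT' : ∀ i ∈ T, F i = i := fun i hi => hFT i (by simp [hi])
    have hkT' : k ∉ T := fun h => hkT (by simp [h])
    have hfib : ∑ g ∈ Finset.univ.filter (fun g : V → V =>
          (∀ j, j ∉ insert t T → g j = F j) ∧ ∀ j ∈ U, Reach g j k), ∏ i ∈ insert t T, c (g i) =
        ∑ v, c v * ∑ g ∈ Finset.univ.filter (fun g : V → V =>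
          (∀ j, j ∉ T → g j = Function.update F t v j) ∧ ∀ j ∈ U, Reach g j k),
            ∏ i ∈ T, c (g i) := by
      rw [← Finset.sum_fiberwise _ (fun g : V → V => g t)]
      refine Finset.sum_congr rfl fun v _ => ?_
      rw [Finset.mul_sum]
      refine Finset.sum_congr ?_ ?_
      · ext g
        simp only [Finset.mem_filter, Finset.mem_univ, true_and, Finset.mem_insert, not_or]
        constructor
        · rintro ⟨⟨h1, h2⟩, h3⟩
          refine ⟨fun j hj => ?_, h2⟩
          by_cases hjt : j = t
          · subst hjt
            simpa using h3
          · rw [Function.update_of_ne hjt]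
            exact h1 j ⟨hjt, hj⟩
        · rintro ⟨h1, h2⟩
          refine ⟨⟨fun j hj => ?_, h2⟩, ?_⟩
          · rw [h1 j hj.2, Function.update_of_ne hj.1]
          · rw [h1 t htT, Function.update_self]
      · intro g hg
        simp only [Finset.mem_filter, Finset.mem_univ, true_and] at hg
        rw [Finset.prod_insert htT, hg.1 t htT, Function.update_self]
    have hterm : ∀ v, (∑ v, c v) * (c v * ∑ g ∈ Finset.univ.filter (fun g : V → V =>
          (∀ j, j ∉ T → g j = Function.update F t v j) ∧ ∀ j ∈ U, Reach g j k),
            ∏ i ∈ T, c (g i)) = (∑ v, c v) ^ T.card *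
        if ∀ j ∈ U, ∃ r ∈ insert k (insert t T), Reach F j r then
          (if Reach F v t then 0 else c v) * (∑ p ∈ Finset.univ.filter (fun p => Reach F p k), c p)
            + (if Reach F v k then c v else 0) *
              (∑ p ∈ Finset.univ.filter (fun p => Reach F p t), c p) else 0 := by
      intro v
      by_cases hvU : v ∈ U
      swap
      · simp [hc v hvU]
      rw [mul_left_comm, ih hkT' (fun i hi => hTU i (by simp [hi])) _
        (by rw [Function.update_of_ne hkt, hFk])
        (fun i hi => by
          rw [Function.update_of_ne (ne_of_mem_of_not_mem hi htT), hFT' i hi])]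
      rw [mul_left_comm]
      congr 1
      simp only [forest_update_iff hFk hFT' ht htT hkt htU hvU]
      by_cases hforest : ∀ j ∈ U, ∃ r ∈ insert k (insert t T), Reach F j r
      swap
      · rw [if_neg (fun h => hforest h.1), if_neg hforest, mul_zero]
      rw [if_pos hforest]
      by_cases hvt : Reach F v t
      · have hvk : ¬ Reach F v k := fun h => hkt (h.unique hvt hFk ht)
        rw [if_neg (fun h => h.2 hvt), if_pos hvt, if_neg hvk]
        simp
      · rw [if_pos ⟨hforest, hvt⟩, if_neg hvt]
        simp only [reach_update_iff ht hkt]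
        by_cases hvk : Reach F v k
        · have hdisj : Disjoint (Finset.univ.filter (fun p => Reach F p k))
              (Finset.univ.filter (fun p => Reach F p t)) := by
            rw [Finset.disjoint_filter]
            exact fun p _ h1 h2 => hkt (h1.unique h2 hFk ht)
          simp only [hvk, and_true, if_true]
          rw [Finset.filter_or, Finset.sum_union hdisj, mul_add]
        · simp [hvk]
    rw [hfib, Finset.mul_sum, Finset.sum_congr rfl fun v _ => hterm v, ← Finset.mul_sum,
      Finset.card_insert_of_notMem htT, pow_succ, mul_assoc]
    congr 1
    split_ifs with hforest
    · rw [Finset.sum_add_distrib, ← Finset.sum_mul, ← Finset.sum_mul]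
      have hsplit : ∑ v, c v = (∑ v, if Reach F v t then 0 else c v) +
          ∑ p ∈ Finset.univ.filter (fun p => Reach F p t), c p := by
        rw [Finset.sum_filter, ← Finset.sum_add_distrib]
        refine Finset.sum_congr rfl fun v _ => ?_
        split_ifs <;> simp
      rw [hsplit, ← Finset.sum_filter (fun v => Reach F v k)]
      ring
    · simp

/-- The function that sends `o` to `p`, the vertices of `T` to `o`, and agrees with `F` elsewhere
is a spanning `k`-tree iff `F` is a forest with roots `T ∪ {k}` and `p` lies in the tree of `k`. -/
theorem tree_through_iff {V : Type*} [DecidableEq V] {o k p : V} {T : Finset V} {F f : V → V} (hko : k ≠ o)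
    (hoT : o ∉ T) (hkT : k ∉ T) (hFo : F o = o) (hFk : F k = k) (hFT : ∀ t ∈ T, F t = t)
    (hfo : f o = p) (hfT : ∀ t ∈ T, f t = o) (hfF : ∀ j, j ≠ o → j ∉ T → f j = F j) :
    ((∀ j, Reach f j k) ∧ ∀ j, j ≠ o → j ∉ T → f j ≠ o) ↔
      (∀ j ∈ {j | j ≠ o}, ∃ r ∈ insert k T, Reach F j r) ∧ Reach F p k := by
  constructor
  · rintro ⟨htree, hz⟩
    constructor
    · intro j hj
      refine (htree j).head_induction
        (P := fun j => j ≠ o → ∃ r ∈ insert k T, Reach F j r) ?_ ?_ hj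
      · exact fun _ => ⟨k, by simp, Reach.refl _ _⟩
      · intro i _ ih hio
        by_cases hiT : i ∈ T
        · exact ⟨i, by simp [hiT], Reach.refl _ _⟩
        · obtain ⟨r, hr, h⟩ := ih (hz i hio hiT)
          rw [hfF i hio hiT] at h
          exact ⟨r, hr, h.step⟩
    · have key := (htree p).head_induction (P := fun i => Reach F i k ∨ Reach F p k)
        (Or.inl (Reach.refl _ _)) (by
          intro i _ ih
          by_cases hio : i = o
          · subst hio
            rw [hfo] at ih
            exact Or.inr (ih.elim id id)
          by_cases hiT : i ∈ T
          · rw [hfT i hiT] at ih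
            exact Or.inr (ih.resolve_left fun h => hko (h.eq_of_fixed hFo).symm)
          · rw [hfF i hio hiT] at ih
            exact ih.imp_left Reach.step)
      exact key.elim id id
  · rintro ⟨hforest, hp⟩
    have hpk : Reach f p k := by
      obtain ⟨m, hm⟩ := hp
      clear hfo
      induction m generalizing p with
      | zero => exact ⟨0, hm⟩
      | succ m ih =>
        have hne : F p ≠ p ∨ p = k := by
          by_contra! h
          exact h.2 (Reach.eq_of_fixed ⟨_, hm⟩ h.1)
        rcases hne with hne | rfl
        · apply Reach.step
          rw [hfF p (fun h => hne (h ▸ hFo)) (fun h => hne (hFT p h))]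
          exact ih hm
        · exact Reach.refl _ _
    have hok : Reach f o k := Reach.step (hfo ▸ hpk)
    have hTk : ∀ t ∈ T, Reach f t k := fun t ht => Reach.step ((hfT t ht).symm ▸ hok)
    refine ⟨fun j => ?_, fun j hjo hjT hfj => ?_⟩
    · by_cases hjo : j = o
      · exact hjo ▸ hok
      obtain ⟨r, hr, hjr⟩ := hforest j hjo
      refine hjr.head_induction (P := fun i => Reach f i k) ?_ ?_
      · rcases Finset.mem_insert.1 hr with rfl | hr
        · exact Reach.refl _ _
        · exact hTk r hr
      · intro i _ ih
        by_cases hio : i = o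
        · exact hio ▸ hok
        by_cases hiT : i ∈ T
        · exact hTk i hiT
        · apply Reach.step
          rwa [hfF i hio hiT]
    · obtain ⟨r, hr, hjr⟩ := hforest j hjo
      rw [hfF j hjo hjT] at hfj
      have hFr : F r = r := by
        rcases Finset.mem_insert.1 hr with rfl | hr
        · exact hFk
        · exact hFT r hr
      have h := hjr.apply hFr
      rw [hfj] at h
      have hor := h.eq_of_fixed hFo
      subst hor
      rcases Finset.mem_insert.1 hr with h | h
      · exact hko h.symm
      · exact hoT h

end SpanningTree

open SpanningTree

/-- **One-step version of Sonin's lemma in a commutative semifield.**  Vertices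
are `Fin n` (vertex `0` stands for state `1`).  With `s1 = ∑_{j ≠ 0} a 0 j ≠ 0`
and reduced matrix `b k l = a k l + a k 0 * s1⁻¹ * a 0 l` on the vertex set
`{k : k ≠ 0}`, the rooted spanning tree vector `w` of `a` (on all vertices) and
the rooted spanning tree vector `w1` of `b` (on the vertices `≠ 0`) satisfy
`s1 * w1 k = w k` for every `k ≠ 0`. -/
theorem stmt_6 {S : Type*} [Semifield S] {n : ℕ} [NeZero n] (hn : 2 ≤ n)
    (a : Fin n → Fin n → S)
    (s1 : S) (hs1 : s1 = ∑ j ∈ Finset.univ.filter (fun j : Fin n => j ≠ 0), a 0 j)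
    (hs1ne : s1 ≠ 0)
    (b : Fin n → Fin n → S)
    (hb : ∀ k l : Fin n, k ≠ 0 → l ≠ 0 → b k l = a k l + a k 0 * s1⁻¹ * a 0 l)
    (w : Fin n → S)
    (hw : ∀ i : Fin n, w i =
      ∑ f ∈ Finset.univ.filter
          (fun f : Fin n → Fin n => f i = i ∧ ∀ j : Fin n, ∃ m : ℕ, f^[m] j = i),
        ∏ j ∈ Finset.univ.filter (fun j : Fin n => j ≠ i), a j (f j))
    (w1 : Fin n → S)
    (hw1 : ∀ k : Fin n, k ≠ 0 → w1 k =
      ∑ f ∈ Finset.univ.filter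
          (fun f : Fin n → Fin n => f 0 = 0 ∧ (∀ j : Fin n, j ≠ 0 → f j ≠ 0) ∧
            f k = k ∧ ∀ j : Fin n, j ≠ 0 → ∃ m : ℕ, f^[m] j = k),
        ∏ j ∈ Finset.univ.filter (fun j : Fin n => j ≠ 0 ∧ j ≠ k), b j (f j)) :
    ∀ k : Fin n, k ≠ 0 → s1 * w1 k = w k := by
  intro k hk
  set c : Fin n → S := fun j => if j = 0 then 0 else a 0 j with hcdef
  have hcs : ∑ v, c v = s1 := by
    rw [hs1, Finset.sum_filter]
    refine Finset.sum_congr rfl fun v _ => ?_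
    simp only [hcdef]
    split_ifs <;> simp_all
  set D : Finset (Fin n) := Finset.univ.filter (fun j : Fin n => j ≠ 0 ∧ j ≠ k) with hD
  have hmemD : ∀ j, j ∈ D ↔ j ≠ 0 ∧ j ≠ k := by simp [hD]
  set G := Finset.univ.filter
          (fun f : Fin n → Fin n => f 0 = 0 ∧ (∀ j : Fin n, j ≠ 0 → f j ≠ 0) ∧
            f k = k ∧ ∀ j : Fin n, j ≠ 0 → ∃ m : ℕ, f^[m] j = k) with hG
  set H := Finset.univ.filter
          (fun f : Fin n → Fin n => f k = k ∧ ∀ j : Fin n, ∃ m : ℕ, f^[m] j = k) with hH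
  have hprodk : ∀ f : Fin n → Fin n,
      ∏ j ∈ Finset.univ.filter (fun j : Fin n => j ≠ k), a j (f j) =
        a 0 (f 0) * ∏ j ∈ D, a j (f j) := by
    intro f
    have h0D : (0 : Fin n) ∉ D := fun h => ((hmemD 0).1 h).1 rfl
    rw [← Finset.prod_insert (f := fun j => a j (f j)) h0D]
    refine Finset.prod_congr ?_ fun _ _ => rfl
    ext j
    simp only [Finset.mem_filter, Finset.mem_univ, true_and, Finset.mem_insert, hmemD]
    by_cases hj : j = 0
    · simp [hj, hk.symm]
    · simp [hj]
  have hexpand : w1 k = ∑ T ∈ D.powerset, ∑ g ∈ G,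
      (∏ j ∈ T, a j 0 * s1⁻¹ * c (g j)) * ∏ j ∈ D \ T, a j (g j) := by
    rw [hw1 k hk, Finset.sum_comm]
    refine Finset.sum_congr rfl fun g hg => ?_
    rw [← Finset.prod_add]
    refine Finset.prod_congr rfl fun j hj => ?_
    have hj0 := ((hmemD j).1 hj).1
    have hgj : g j ≠ 0 := (Finset.mem_filter.1 hg).2.2.1 j hj0
    rw [hb j (g j) hj0 hgj, add_comm]
    simp [hcdef, hgj]
  rw [hexpand, hw k, Finset.mul_sum,
    ← Finset.sum_fiberwise_of_maps_to (s := H) (t := D.powerset)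
      (g := fun f => D.filter (fun j => f j = 0)) (fun f _ => by simp)]
  refine Finset.sum_congr rfl fun T hT => ?_
  have hTD := Finset.mem_powerset.1 hT
  have h0T : (0 : Fin n) ∉ T := fun h => ((hmemD 0).1 (hTD h)).1 rfl
  have hkT : k ∉ T := fun h => ((hmemD k).1 (hTD h)).2 rfl
  let reset : (Fin n → Fin n) → Fin n → Fin n := fun f j => if j = 0 ∨ j ∈ T then j else f j
  rw [← Finset.sum_fiberwise G reset, ← Finset.sum_fiberwise (H.filter _) reset, Finset.mul_sum]
  refine Finset.sum_congr rfl fun F _ => ?_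
  by_cases hF : F 0 = 0 ∧ F k = k ∧ ∀ t ∈ T, F t = t
  swap
  · have hres : ∀ f, f k = k → reset f ≠ F := by
      rintro f hf rfl
      refine hF ⟨by simp [reset], by simp [reset, hf], fun t ht => by simp [reset, ht]⟩
    rw [Finset.sum_eq_zero, Finset.sum_eq_zero, mul_zero]
    · intro f hf
      simp only [hH, Finset.mem_filter, Finset.mem_univ, true_and] at hf
      exact absurd hf.2 (hres f hf.1.1.1)
    · intro f hf
      simp only [hG, Finset.mem_filter, Finset.mem_univ, true_and] at hf
      exact absurd hf.2 (hres f hf.1.2.2.1)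
  obtain ⟨hF0, hFk, hFT⟩ := hF
  have hreset : ∀ f, reset f = F ↔ ∀ j, j ≠ 0 → j ∉ T → f j = F j := by
    intro f
    constructor
    · rintro rfl j hj hjT
      simp [reset, hj, hjT]
    · intro h
      funext j
      by_cases hj : j = 0
      · simp [reset, hj, hF0]
      by_cases hjT : j ∈ T
      · simp [reset, hjT, hFT j hjT]
      · simp [reset, hj, hjT, h j hj hjT]
  have hcore : s1 * ∑ g ∈ Finset.univ.filter (fun g : Fin n → Fin n =>
        (∀ j, j ∉ T → g j = F j) ∧ ∀ j ∈ {j : Fin n | j ≠ 0}, Reach g j k), ∏ t ∈ T, c (g t) =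
      s1 ^ T.card * if ∀ j ∈ {j : Fin n | j ≠ 0}, ∃ r ∈ insert k T, Reach F j r then
        ∑ p ∈ Finset.univ.filter (fun p => Reach F p k), c p else 0 := by
    have h := sum_forest_completions {j : Fin n | j ≠ 0} c (by simp [hcdef]) k T hkT
      (fun t ht => ((hmemD t).1 (hTD ht)).1) F hFk hFT
    rw [hcs] at h
    convert h
  have hGF : G.filter (fun g => reset g = F) = Finset.univ.filter
      (fun g : Fin n → Fin n => (∀ j, j ∉ T → g j = F j) ∧
        ∀ j ∈ {j : Fin n | j ≠ 0}, Reach g j k) := by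
    ext g
    simp only [hG, Finset.mem_filter, Finset.mem_univ, true_and, hreset, Set.mem_ofPred_eq]
    constructor
    · rintro ⟨⟨hg0, _, _, hg⟩, h⟩
      refine ⟨fun j hj => ?_, hg⟩
      by_cases hj0 : j = 0
      · rw [hj0, hg0, hF0]
      · exact h j hj0 hj
    · rintro ⟨h, hg⟩
      have hg0 : g 0 = 0 := (h 0 h0T).trans hF0
      have hgk : g k = k := (h k hkT).trans hFk
      refine ⟨⟨hg0, fun j hj hgj => ?_, hgk, hg⟩, fun j _ hj => h j hj⟩
      have h1 := (hg j hj).apply hgk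
      rw [hgj] at h1
      exact hk (h1.eq_of_fixed hg0).symm
  set W : S := (∏ j ∈ T, a j 0) * ∏ j ∈ D \ T, a j (F j) with hW
  have hD0 : ∀ j ∈ D \ T, j ≠ 0 ∧ j ∉ T := fun j hj =>
    ⟨((hmemD j).1 (Finset.mem_sdiff.1 hj).1).1, (Finset.mem_sdiff.1 hj).2⟩
  have hL : ∑ g ∈ G.filter (fun g => reset g = F),
      (∏ j ∈ T, a j 0 * s1⁻¹ * c (g j)) * ∏ j ∈ D \ T, a j (g j) =
      W * s1⁻¹ ^ T.card * ∑ g ∈ G.filter (fun g => reset g = F), ∏ t ∈ T, c (g t) := by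
    rw [Finset.mul_sum]
    refine Finset.sum_congr rfl fun g hg => ?_
    have hg' := (hreset g).1 (Finset.mem_filter.1 hg).2
    rw [Finset.prod_mul_distrib, Finset.prod_mul_distrib, Finset.prod_const,
      Finset.prod_congr (s₁ := D \ T) rfl fun j hj => by rw [hg' j (hD0 j hj).1 (hD0 j hj).2], hW]
    ring
  have hR : ∑ f ∈ (H.filter (fun f => D.filter (fun j => f j = 0) = T)).filter
        (fun f => reset f = F), ∏ j ∈ Finset.univ.filter (fun j : Fin n => j ≠ k), a j (f j) =
      W * if ∀ j ∈ {j : Fin n | j ≠ 0}, ∃ r ∈ insert k T, Reach F j r then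
        ∑ p ∈ Finset.univ.filter (fun p => Reach F p k), c p else 0 := by
    have hmem : ∀ f, f ∈ (H.filter (fun f => D.filter (fun j => f j = 0) = T)).filter
        (fun f => reset f = F) ↔ (∀ t ∈ T, f t = 0) ∧ (∀ j, j ≠ 0 → j ∉ T → f j = F j) ∧
          (∀ j ∈ {j : Fin n | j ≠ 0}, ∃ r ∈ insert k T, Reach F j r) ∧ Reach F (f 0) k := by
      intro f
      simp only [hH, Finset.mem_filter, Finset.mem_univ, true_and, hreset]
      constructor
      · rintro ⟨⟨⟨hfk, hf⟩, hz⟩, hfF⟩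
        have hfT : ∀ t ∈ T, f t = 0 := by
          intro t ht
          rw [← hz] at ht
          exact (Finset.mem_filter.1 ht).2
        refine ⟨hfT, hfF, (tree_through_iff hk h0T hkT hF0 hFk hFT rfl hfT hfF).1 ⟨hf, ?_⟩⟩
        intro j hj hjT hfj
        apply hjT
        rw [← hz, Finset.mem_filter, hmemD]
        refine ⟨⟨hj, ?_⟩, hfj⟩
        rintro rfl
        exact hj (hfk.symm.trans hfj)
      · rintro ⟨hfT, hfF, h⟩
        obtain ⟨h1, h2⟩ := (tree_through_iff hk h0T hkT hF0 hFk hFT rfl hfT hfF).2 h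
        refine ⟨⟨⟨(hfF k hk hkT).trans hFk, h1⟩, ?_⟩, hfF⟩
        ext j
        simp only [Finset.mem_filter]
        constructor
        · rintro ⟨hj, hfj⟩
          by_contra hjT
          exact h2 j ((hmemD j).1 hj).1 hjT hfj
        · exact fun hj => ⟨hTD hj, hfT j hj⟩
    split_ifs with hforest
    · rw [Finset.mul_sum]
      refine Finset.sum_bij' (fun f _ => f 0)
        (fun p _ j => if j = 0 then p else if j ∈ T then 0 else F j) ?_ ?_ ?_ ?_ ?_
      · intro f hf
        simpa using ((hmem f).1 hf).2.2.2
      · intro p hp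
        rw [hmem]
        refine ⟨fun t ht => ?_, fun j hj hjT => ?_, hforest, by simpa using hp⟩
        · have : t ≠ 0 := fun h => h0T (h ▸ ht)
          simp [this, ht]
        · simp [hj, hjT]
      · intro f hf
        obtain ⟨h1, h2, _⟩ := (hmem f).1 hf
        funext j
        split_ifs with hj hjT
        · rw [hj]
        · exact (h1 j hjT).symm
        · exact (h2 j hj hjT).symm
      · intro p _
        simp
      · intro f hf
        obtain ⟨h1, h2, _, h3⟩ := (hmem f).1 hf
        have hf0 : f 0 ≠ 0 := by
          intro h
          rw [h] at h3
          exact hk (h3.eq_of_fixed hF0).symm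
        rw [hprodk, ← Finset.prod_sdiff hTD,
          Finset.prod_congr (s₁ := D \ T) rfl fun j hj => by rw [h2 j (hD0 j hj).1 (hD0 j hj).2],
          Finset.prod_congr (s₁ := T) rfl fun j hj => by rw [h1 j hj]]
        simp only [hcdef, hf0, if_false, hW]
        ring
    · rw [mul_zero, Finset.sum_eq_zero]
      intro f hf
      exact absurd ((hmem f).1 hf).2.2.1 hforest
  rw [hR, hL, hGF, mul_left_comm s1, hcore, ← mul_assoc, mul_assoc W, ← mul_pow,
    inv_mul_cancel₀ hs1ne, one_pow, mul_one]
end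

section
/- Let S be a commutative semifield, let n ≥ 2, and let A = (a_{ij}) be an n×n matrix over S such that the reduced matrices A^{(1)}, …, A^{(n-1)} are all defined, i.e. s_i := Σ_{l=i+1}^n a^{(i-1)}_{il} ≠ 0 for all 1 ≤ i ≤ n−1. Then for every i with 1 ≤ i ≤ n−1 and every k with i < k ≤ n, s_i · w^{(i)}_k = w^{(i-1)}_k, where w^{(i)} denotes the rooted spanning tree vector of A^{(i)} (and w^{(0)} that of A). -/
open scoped Classical

/-- The rooted spanning tree vector of the matrix `b` restricted to the vertex
set `V ⊆ Fin n`:  a spanning `k`-tree on `V` is encoded by `f : Fin n → Fin n`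
fixing every vertex outside `V`, mapping `V` into `V`, with `f k = k` and every
vertex of `V` reaching `k` under iteration; its weight is
`∏_{j ∈ V, j ≠ k} b j (f j)`. -/
noncomputable def rstVec {S : Type*} [CommSemiring S] {n : ℕ}
    (V : Finset (Fin n)) (b : Fin n → Fin n → S) (k : Fin n) : S :=
  ∑ f ∈ Finset.univ.filter (fun f : Fin n → Fin n =>
      (∀ j ∉ V, f j = j) ∧ (∀ j ∈ V, f j ∈ V) ∧ f k = k ∧
        ∀ j ∈ V, ∃ m : ℕ, f^[m] j = k),
    ∏ j ∈ V.filter (fun j => j ≠ k), b j (f j)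

section Reaches

variable {α : Type*}

/-- The forward orbit of `u` under `f` contains `v`. -/
def Reaches (f : α → α) (u v : α) : Prop := ∃ m : ℕ, f^[m] u = v

theorem Reaches.refl (f : α → α) (u : α) : Reaches f u u := ⟨0, rfl⟩

theorem Reaches.head {f : α → α} {u v : α} (h : Reaches f (f u) v) : Reaches f u v := by
  obtain ⟨m, hm⟩ := h
  exact ⟨m + 1, hm⟩

theorem Reaches.trans {f : α → α} {u v w : α} (h : Reaches f u v) (h' : Reaches f v w) :
    Reaches f u w := by
  obtain ⟨m, rfl⟩ := h
  obtain ⟨p, rfl⟩ := h'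
  exact ⟨p + m, Function.iterate_add_apply f p m u⟩

theorem Reaches.tail_of_ne {f : α → α} {u v : α} (h : Reaches f u v) (hne : u ≠ v) :
    Reaches f (f u) v := by
  obtain ⟨m, hm⟩ := h
  cases m with
  | zero => exact absurd hm hne
  | succ m => exact ⟨m, hm⟩

@[elab_as_elim]
theorem Reaches.induction {f : α → α} {v : α} {P : α → Prop} {u : α} (h : Reaches f u v)
    (base : P v) (step : ∀ u, u ≠ v → Reaches f (f u) v → P (f u) → P u) : P u := by
  obtain ⟨m, hm⟩ := h
  induction m generalizing u with
  | zero =>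
    obtain rfl : u = v := hm
    exact base
  | succ m ih =>
    by_cases huv : u = v
    · exact huv ▸ base
    · exact step u huv ⟨m, hm⟩ (ih hm)

theorem Reaches.total {f : α → α} {u v w : α} (hv : Reaches f u v) (hw : Reaches f u w) :
    Reaches f v w ∨ Reaches f w v := by
  obtain ⟨m, rfl⟩ := hv
  obtain ⟨p, rfl⟩ := hw
  rcases le_total m p with h | h
  · left
    exact ⟨p - m, by rw [← Function.iterate_add_apply, Nat.sub_add_cancel h]⟩
  · right
    exact ⟨m - p, by rw [← Function.iterate_add_apply, Nat.sub_add_cancel h]⟩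

variable [DecidableEq α]

theorem Reaches.update_target {f : α → α} {u j : α} (a : α) (h : Reaches f u j) :
    Reaches (Function.update f j a) u j := by
  refine h.induction (Reaches.refl _ _) fun u hu _ ih => Reaches.head ?_
  rwa [Function.update_of_ne hu]

theorem reaches_update_target {f : α → α} {u j a : α} :
    Reaches (Function.update f j a) u j ↔ Reaches f u j := by
  refine ⟨fun h => ?_, Reaches.update_target a⟩
  have := h.update_target (f j)
  rwa [Function.update_idem, Function.update_eq_self] at this

theorem Reaches.update_of_not_reaches {f : α → α} {u v t : α} (a : α) (h : Reaches f u v)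
    (ht : ¬ Reaches f u t) : Reaches (Function.update f t a) u v := by
  revert ht
  refine h.induction (fun _ => Reaches.refl _ _) fun u _ _ ih ht => Reaches.head ?_
  have hut : u ≠ t := by
    rintro rfl
    exact ht (Reaches.refl _ _)
  rw [Function.update_of_ne hut]
  exact ih fun h => ht h.head

theorem Reaches.update_of_not_reaches_target {f : α → α} {u v t : α} (a : α) (h : Reaches f u v)
    (ht : ¬ Reaches f t v) : Reaches (Function.update f t a) u v := by
  refine h.induction (Reaches.refl _ _) fun u _ hr ih => Reaches.head ?_
  have hut : u ≠ t := by
    rintro rfl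
    exact ht hr.head
  rwa [Function.update_of_ne hut]

theorem Reaches.of_update_of_not_reaches {f : α → α} {u v t a : α}
    (h : Reaches (Function.update f t a) u v) (ht : ¬ Reaches f u t) : Reaches f u v := by
  have := h.update_of_not_reaches (f t) (fun h' => ht (reaches_update_target.1 h'))
  rwa [Function.update_idem, Function.update_eq_self] at this

end Reaches

section SpanningTree

variable {α : Type*}

/-- `f` encodes a spanning tree on `V` rooted at `k`. -/
structure IsSpanningTree (V : Finset α) (k : α) (f : α → α) : Prop where
  fix : ∀ j ∉ V, f j = j
  maps : ∀ j ∈ V, f j ∈ V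
  root : f k = k
  reaches : ∀ j ∈ V, Reaches f j k

namespace IsSpanningTree

variable {V : Finset α} {k : α} {f : α → α}

theorem not_reaches_self (hf : IsSpanningTree V k f) {v : α} (hv : v ∈ V) (hvk : v ≠ k) :
    ¬ Reaches f (f v) v := by
  rintro ⟨m, hm⟩
  obtain ⟨p, hp⟩ := hf.reaches v hv
  have hper : f^[m + 1] v = v := hm
  have hk : ∀ q, f^[q] k = k := fun q => Function.iterate_fixed hf.root q
  have h1 : f^[(m + 1) * p] v = v := by
    rw [Function.iterate_mul]
    exact Function.iterate_fixed hper p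
  have h2 : f^[(m + 1) * p] v = k := by
    rw [add_mul, one_mul, Function.iterate_add_apply, hp, hk]
  exact hvk (h1.symm.trans h2)

variable [DecidableEq α]

theorem update (hf : IsSpanningTree V k f) {j c : α} (hj : j ∈ V) (hjk : j ≠ k) (hc : c ∈ V)
    (hcj : ¬ Reaches f c j) : IsSpanningTree V k (Function.update f j c) where
  fix v hv := by
    rw [Function.update_of_ne (ne_of_mem_of_not_mem hj hv).symm, hf.fix v hv]
  maps v hv := by
    by_cases h : v = j
    · subst h
      rwa [Function.update_self]
    · rw [Function.update_of_ne h]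
      exact hf.maps v hv
  root := by rw [Function.update_of_ne hjk.symm, hf.root]
  reaches v hv := by
    refine (hf.reaches v hv).induction (Reaches.refl _ _) fun u _ _ ih => Reaches.head ?_
    by_cases h : u = j
    · subst h
      rw [Function.update_self]
      exact (hf.reaches c hc).update_of_not_reaches c hcj
    · rwa [Function.update_of_ne h]

variable {j t : α}

theorem detach_through (hf : IsSpanningTree V k f) (hj : j ∈ V) (ht : t ∈ V) (hjk : j ≠ k)
    (htk : t ≠ k) (hjt : j ≠ t) (h : Reaches f t j) :
    IsSpanningTree V k (Function.update (Function.update f t (f j)) j t) := by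
  have h1 : ¬ Reaches f (f j) t := fun h' => hf.not_reaches_self hj hjk (h'.trans h)
  refine (hf.update ht htk (hf.maps j hj) h1).update hj hjk ht fun h2 => ?_
  have h3 := h2.tail_of_ne hjt.symm
  rw [Function.update_self] at h3
  exact hf.not_reaches_self hj hjk (h3.of_update_of_not_reaches h1)

theorem attach_through (hf : IsSpanningTree V k f) (hj : j ∈ V) (ht : t ∈ V) (hjk : j ≠ k)
    (htk : t ≠ k) (hjt : j ≠ t) (hft : f j = t) {c : α} (hc : c ∈ V) (h : Reaches f c j) :
    IsSpanningTree V k (Function.update (Function.update f t c) j (f t)) := by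
  have htj : ¬ Reaches f t j := by
    have := hf.not_reaches_self hj hjk
    rwa [hft] at this
  have h1 : ¬ Reaches f (f t) j := fun h' => htj h'.head
  rw [Function.update_comm hjt.symm]
  refine (hf.update hj hjk (hf.maps t ht) h1).update ht htk hc fun h2 => ?_
  rcases h2.total (h.update_target (f t)) with h3 | h3
  · exact htj (reaches_update_target.1 h3)
  · have h4 := h3.tail_of_ne hjt
    rw [Function.update_self] at h4
    exact hf.not_reaches_self ht htk (h4.of_update_of_not_reaches h1)

end IsSpanningTree

end SpanningTree

section Sums

variable {S : Type*} {n : ℕ}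

theorem rstVec_eq [CommSemiring S] (V : Finset (Fin n)) (b : Fin n → Fin n → S) (k : Fin n) :
    rstVec V b k = ∑ f with IsSpanningTree V k f, ∏ j ∈ V.erase k, b j (f j) := by
  unfold rstVec
  refine Finset.sum_congr (Finset.filter_congr fun f _ => ?_) fun f _ => ?_
  · exact ⟨fun ⟨h1, h2, h3, h4⟩ => ⟨h1, h2, h3, h4⟩, fun ⟨h1, h2, h3, h4⟩ => ⟨h1, h2, h3, h4⟩⟩
  · rw [Finset.filter_ne']

theorem rstVec_congr [CommSemiring S] {V : Finset (Fin n)} {b b' : Fin n → Fin n → S} {k : Fin n}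
    (h : ∀ j ∈ V, j ≠ k → ∀ l ∈ V, l ≠ j → b j l = b' j l) : rstVec V b k = rstVec V b' k := by
  rw [rstVec_eq, rstVec_eq]
  refine Finset.sum_congr rfl fun f hf => Finset.prod_congr rfl fun j hj => ?_
  have hf := (Finset.mem_filter.1 hf).2
  obtain ⟨hjk, hj⟩ := Finset.mem_erase.1 hj
  refine h j hj hjk _ (hf.maps j hj) fun hfj => hf.not_reaches_self hj hjk ?_
  rw [hfj]
  exact Reaches.refl _ _

/-- Trees with `j → t` together with a free vertex `c` are equinumerous, weight-preservingly,
with all trees, when `j` and `t` carry the same weights. -/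
theorem sum_mul_sum_spanningTree_through [CommSemiring S] {V : Finset (Fin n)} {j t k : Fin n}
    (hj : j ∈ V) (ht : t ∈ V) (hjk : j ≠ k) (htk : t ≠ k) (hjt : j ≠ t) (b : Fin n → Fin n → S) :
    (∑ c ∈ V, b t c) * ∑ f with IsSpanningTree V k f ∧ f j = t,
        ∏ i ∈ (V.erase k).erase j, b i (f i) =
      ∑ f with IsSpanningTree V k f, b t (f j) * ∏ i ∈ (V.erase k).erase j, b i (f i) := by
  have htm : t ∈ (V.erase k).erase j := by simp [*, hjt.symm]
  rw [Finset.sum_mul_sum, ← Finset.sum_product']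
  symm
  refine Finset.sum_bij'
    (fun f _ => if Reaches f t j then
      (f t, Function.update (Function.update f t (f j)) j t) else (f j, Function.update f j t))
    (fun p _ => if Reaches p.2 p.1 j then
      Function.update (Function.update p.2 t p.1) j (p.2 t) else Function.update p.2 j p.1)
    ?_ ?_ ?_ ?_ ?_
  · intro f hf
    have hf := (Finset.mem_filter.1 hf).2
    split_ifs with h
    · simp [hf.maps t ht, hf.detach_through hj ht hjk htk hjt h]
    · simp [hf.maps j hj, hf.update hj hjk ht h]
  · rintro ⟨c, g⟩ hp
    simp only [Finset.mem_product, Finset.mem_filter, Finset.mem_univ, true_and] at hp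
    obtain ⟨hc, hg, hgj⟩ := hp
    simp only [Finset.mem_filter, Finset.mem_univ, true_and]
    split_ifs with h
    · exact hg.attach_through hj ht hjk htk hjt hgj hc h
    · exact hg.update hj hjk hc h
  · intro f hf
    have hf := (Finset.mem_filter.1 hf).2
    by_cases h : Reaches f t j
    · have h1 : Reaches (Function.update (Function.update f t (f j)) j t) (f t) j :=
        ((h.tail_of_ne hjt.symm).update_of_not_reaches _
          (hf.not_reaches_self ht htk)).update_target _
      simp only [if_pos h, if_pos h1]
      funext v
      by_cases hvj : v = j
      · subst hvj; simp [hjt.symm]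
      · by_cases hvt : v = t
        · subst hvt; simp [hvj]
        · simp [hvj, hvt]
    · have h1 : ¬ Reaches (Function.update f j t) (f j) j := fun h' =>
        hf.not_reaches_self hj hjk (reaches_update_target.1 h')
      simp only [if_neg h, if_neg h1]
      simp
  · rintro ⟨c, g⟩ hp
    simp only [Finset.mem_product, Finset.mem_filter, Finset.mem_univ, true_and] at hp
    obtain ⟨hc, hg, hgj⟩ := hp
    have htj : ¬ Reaches g t j := by
      have := hg.not_reaches_self hj hjk
      rwa [hgj] at this
    by_cases h : Reaches g c j
    · have h1 : Reaches (Function.update (Function.update g t c) j (g t)) t j := by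
        refine Reaches.update_target _ (Reaches.head ?_)
        rw [Function.update_self]
        exact h.update_of_not_reaches_target c htj
      simp only [if_pos h, if_pos h1]
      refine Prod.ext (by simp [hjt.symm]) ?_
      funext v
      by_cases hvj : v = j
      · subst hvj; simp [hgj]
      · by_cases hvt : v = t
        · subst hvt; simp [hvj]
        · simp [hvj, hvt]
    · have h1 : ¬ Reaches (Function.update g j c) t j := fun h' =>
        htj (reaches_update_target.1 h')
      simp only [if_neg h, if_neg h1]
      simp [← hgj]
  · intro f hf
    have hcongr : ∀ g : Fin n → Fin n, (∀ v, v ≠ j → v ≠ t → g v = f v) →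
        ∏ i ∈ ((V.erase k).erase j).erase t, b i (g i) =
          ∏ i ∈ ((V.erase k).erase j).erase t, b i (f i) := fun g hg =>
      Finset.prod_congr rfl fun i hi => by
        simp only [Finset.mem_erase] at hi
        rw [hg i hi.2.1 hi.1]
    rw [← Finset.mul_prod_erase _ _ htm]
    split_ifs with h
    · rw [← Finset.mul_prod_erase _ _ htm, hcongr (Function.update (Function.update f t (f j)) j t)
        (fun v h1 h2 => by simp [h1, h2])]
      simp only [Function.update_of_ne hjt.symm, Function.update_self]
      ring
    · rw [← Finset.mul_prod_erase _ _ htm, hcongr (Function.update f j t)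
        (fun v h1 h2 => by simp [h1])]
      simp only [Function.update_of_ne hjt.symm]

/-- Row `j` of the matrix obtained from `b` by suppressing the vertex `t` with pivot `s`. -/
noncomputable def reducedRow [Semifield S] (b : Fin n → Fin n → S) (t : Fin n) (s : S)
    (j l : Fin n) : S :=
  (if l = t then 0 else b j l) + b j t * s⁻¹ * b t l

theorem rstVec_update_reducedRow [Semifield S] {V : Finset (Fin n)} {j t k : Fin n}
    (hj : j ∈ V) (ht : t ∈ V) (hjk : j ≠ k) (htk : t ≠ k) (hjt : j ≠ t)
    (b : Fin n → Fin n → S) {s : S} (hs : ∑ c ∈ V, b t c = s) (hs0 : s ≠ 0) :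
    rstVec V (Function.update b j (reducedRow b t s j)) k = rstVec V b k := by
  have hjm : j ∈ V.erase k := Finset.mem_erase.2 ⟨hjk, hj⟩
  have hrow : ∀ (r : Fin n → S), rstVec V (Function.update b j r) k =
      ∑ f with IsSpanningTree V k f, r (f j) * ∏ i ∈ (V.erase k).erase j, b i (f i) := fun r => by
    rw [rstVec_eq]
    refine Finset.sum_congr rfl fun f _ => ?_
    rw [← Finset.mul_prod_erase _ _ hjm, Function.update_self]
    congr 1
    refine Finset.prod_congr rfl fun i hi => ?_
    rw [Function.update_of_ne (Finset.ne_of_mem_erase hi)]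
  have hb : rstVec V b k = rstVec V (Function.update b j
      (fun l => (if l = t then 0 else b j l) + if l = t then b j t else 0)) k := by
    conv_lhs => rw [← Function.update_eq_self j b]
    congr 2
    funext l
    split_ifs with h <;> simp [h]
  rw [hb, hrow, hrow]
  simp only [reducedRow, add_mul, Finset.sum_add_distrib]
  congr 1
  have key := sum_mul_sum_spanningTree_through hj ht hjk htk hjt b
  rw [hs] at key
  calc _ = b j t * s⁻¹ * ∑ f with IsSpanningTree V k f,
          b t (f j) * ∏ i ∈ (V.erase k).erase j, b i (f i) := by
        simp only [Finset.mul_sum, mul_assoc]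
    _ = b j t * ∑ f with IsSpanningTree V k f ∧ f j = t,
          ∏ i ∈ (V.erase k).erase j, b i (f i) := by
        rw [← key, ← mul_assoc, mul_assoc (b j t), inv_mul_cancel₀ hs0, mul_one]
    _ = _ := by
        rw [Finset.mul_sum, ← Finset.filter_filter, Finset.sum_filter]
        refine Finset.sum_congr rfl fun f _ => ?_
        split_ifs <;> simp

theorem rstVec_reducedRow [Semifield S] {V : Finset (Fin n)} {t k : Fin n}
    (ht : t ∈ V) (htk : t ≠ k) (b : Fin n → Fin n → S) {s : S} (hs : ∑ c ∈ V, b t c = s)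
    (hs0 : s ≠ 0) (U : Finset (Fin n)) (hU : U ⊆ (V.erase k).erase t) :
    rstVec V (fun i => if i ∈ U then reducedRow b t s i else b i) k = rstVec V b k := by
  induction U using Finset.induction_on with
  | empty => simp
  | insert j U hjU ih =>
    have hjm := hU (Finset.mem_insert_self j U)
    simp only [Finset.mem_erase] at hjm
    have hUs : U ⊆ (V.erase k).erase t := (Finset.subset_insert j U).trans hU
    have htU : t ∉ U := fun h => by simpa using hUs h
    rw [← ih hUs, ← rstVec_update_reducedRow hjm.2.2 ht hjm.2.1 htk hjm.1
      (fun i => if i ∈ U then reducedRow b t s i else b i) (s := s) (by simpa [htU] using hs) hs0]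
    congr 1
    funext i
    by_cases hij : i = j
    · subst hij
      funext l
      simp [reducedRow, hjU, htU]
    · simp [hij]

/-- A vertex that no other vertex points to contributes its row sum. -/
theorem rstVec_of_isolated [CommSemiring S] {V : Finset (Fin n)} {t k : Fin n} (ht : t ∈ V)
    (htk : t ≠ k) (b : Fin n → Fin n → S)
    (hb : ∀ j ∈ V, j ≠ k → j ≠ t → b j t = 0) :
    rstVec V b k = (∑ c ∈ V.erase t, b t c) * rstVec (V.erase t) b k := by
  have htm : t ∈ V.erase k := Finset.mem_erase.2 ⟨htk, ht⟩
  have avoid : ∀ (f : Fin n → Fin n), (∀ v ∈ V.erase t, f v ∈ V.erase t) →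
      ∀ v ∈ V.erase t, ¬ Reaches f v t := by
    rintro f hf v hv ⟨m, hm⟩
    have h : f^[m] v ∈ V.erase t :=
      Set.MapsTo.iterate (s := {v | v ∈ V.erase t}) (fun v hv => hf v hv) m hv
    rw [hm] at h
    simp at h
  rw [rstVec_eq, rstVec_eq, Finset.sum_mul_sum, ← Finset.sum_product']
  rw [← Finset.sum_filter_of_ne (p := fun f => ∀ v ∈ V.erase t, f v ∈ V.erase t)]
  · refine Finset.sum_bij' (fun f _ => (f t, Function.update f t t))
      (fun p _ => Function.update p.2 t p.1) ?_ ?_ ?_ ?_ ?_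
    · intro f hf
      simp only [Finset.mem_filter, Finset.mem_univ, true_and] at hf
      obtain ⟨hf, hav⟩ := hf
      have hft : f t ≠ t := fun h => hf.not_reaches_self ht htk (by rw [h]; exact Reaches.refl _ _)
      simp only [Finset.mem_product, Finset.mem_filter, Finset.mem_univ, true_and]
      refine ⟨Finset.mem_erase.2 ⟨hft, hf.maps t ht⟩, ?_, ?_, ?_, ?_⟩
      · intro v hv
        by_cases hvt : v = t
        · simp [hvt]
        · rw [Function.update_of_ne hvt]
          exact hf.fix v fun h => hv (Finset.mem_erase.2 ⟨hvt, h⟩)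
      · intro v hv
        rw [Function.update_of_ne (Finset.ne_of_mem_erase hv)]
        exact hav v hv
      · rw [Function.update_of_ne htk.symm, hf.root]
      · intro v hv
        exact (hf.reaches v (Finset.mem_of_mem_erase hv)).update_of_not_reaches _ (avoid f hav v hv)
    · rintro ⟨c, g⟩ hp
      simp only [Finset.mem_product, Finset.mem_filter, Finset.mem_univ, true_and] at hp ⊢
      obtain ⟨hc, hg⟩ := hp
      have hr : ∀ v ∈ V.erase t, Reaches (Function.update g t c) v k := fun v hv =>
        (hg.reaches v hv).update_of_not_reaches _ (avoid g hg.maps v hv)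
      refine ⟨⟨?_, ?_, ?_, ?_⟩, ?_⟩
      · intro v hv
        rw [Function.update_of_ne (ne_of_mem_of_not_mem ht hv).symm]
        exact hg.fix v fun h => hv (Finset.mem_of_mem_erase h)
      · intro v hv
        by_cases hvt : v = t
        · subst hvt
          rw [Function.update_self]
          exact Finset.mem_of_mem_erase hc
        · rw [Function.update_of_ne hvt]
          exact Finset.mem_of_mem_erase (hg.maps v (Finset.mem_erase.2 ⟨hvt, hv⟩))
      · rw [Function.update_of_ne htk.symm, hg.root]
      · intro v hv
        by_cases hvt : v = t
        · subst hvt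
          refine Reaches.head ?_
          rw [Function.update_self]
          exact hr c hc
        · exact hr v (Finset.mem_erase.2 ⟨hvt, hv⟩)
      · intro v hv
        rw [Function.update_of_ne (Finset.ne_of_mem_erase hv)]
        exact hg.maps v hv
    · intro f _
      simp
    · rintro ⟨c, g⟩ hp
      simp only [Finset.mem_product, Finset.mem_filter, Finset.mem_univ, true_and] at hp
      have hgt : g t = t := hp.2.fix t (by simp)
      refine Prod.ext (by simp) ?_
      simp only [Function.update_idem]
      rw [← hgt, hgt, Function.update_eq_iff]
      exact ⟨hgt.symm, fun _ _ => rfl⟩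
    · intro f _
      rw [← Finset.mul_prod_erase _ _ htm, Finset.erase_right_comm]
      congr 1
      refine Finset.prod_congr rfl fun i hi => ?_
      exact congrArg (b i)
        (Function.update_of_ne (Finset.ne_of_mem_erase (Finset.mem_of_mem_erase hi)) _ _).symm
  · intro f hf hne v hv
    have hf := (Finset.mem_filter.1 hf).2
    obtain ⟨hvt, hvV⟩ := Finset.mem_erase.1 hv
    refine Finset.mem_erase.2 ⟨fun hfv => hne ?_, hf.maps v hvV⟩
    have hvk : v ≠ k := fun h => htk (by rw [← hfv, h, hf.root])
    refine Finset.prod_eq_zero (Finset.mem_erase.2 ⟨hvk, hvV⟩) ?_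
    rw [hfv]
    exact hb v hvV hvk hvt

/-- Suppressing the vertex `t` divides the rooted spanning tree vector by the pivot. -/
theorem mul_rstVec_erase [Semifield S] {V : Finset (Fin n)} {t k : Fin n} (ht : t ∈ V)
    (htk : t ≠ k) (b b' : Fin n → Fin n → S) {s : S}
    (hs : ∑ c ∈ V.erase t, b t c = s) (hs0 : s ≠ 0)
    (hb' : ∀ j ∈ V.erase t, ∀ l ∈ V.erase t, b' j l = b j l + b j t * s⁻¹ * b t l) :
    s * rstVec (V.erase t) b' k = rstVec V b k := by
  set d : Fin n → Fin n → S := Function.update b t (Function.update (b t) t 0) with hd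
  have hdt : d t t = 0 := by simp [hd]
  have hdtl : ∀ l, l ≠ t → d t l = b t l := fun l hl => by simp [hd, hl]
  have hdj : ∀ j, j ≠ t → d j = b j := fun j hj => by simp [hd, hj]
  have hsum : ∑ c ∈ V.erase t, d t c = s := by
    rw [← hs]
    exact Finset.sum_congr rfl fun c hc => hdtl c (Finset.ne_of_mem_erase hc)
  have hsum' : ∑ c ∈ V, d t c = s := by rw [← Finset.add_sum_erase _ _ ht, hdt, zero_add, hsum]
  have h1 : rstVec V b k = rstVec V d k := rstVec_congr fun j _ _ l _ hlj => by
    by_cases h : j = t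
    · subst h; exact (hdtl l hlj).symm
    · rw [hdj j h]
  rw [h1, ← rstVec_reducedRow ht htk d hsum' hs0 _ Finset.Subset.rfl,
    rstVec_of_isolated ht htk]
  · congr 1
    · simpa using hsum.symm
    · refine rstVec_congr fun j hj hjk l hl _ => ?_
      have hjt := Finset.ne_of_mem_erase hj
      have hlt := Finset.ne_of_mem_erase hl
      simp [reducedRow, hb' j hj l hl, hjk, hjt, Finset.mem_of_mem_erase hj, hlt, hdj j hjt,
        hdtl l hlt]
  · intro j hj hjk hjt
    simp [reducedRow, hj, hjk, hjt, hdt]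

end Sums

/-- **Sonin's lemma in a commutative semifield.**  Vertices are `Fin n` (vertex
`t` stands for state `t+1`).  `B m` is the `m`-th reduced matrix (`B 0 = A`;
`B (t+1)`, relevant on indices `> t`, is obtained from `B t` by suppressing
vertex `t`, with pivot `s t = ∑_{l > t} B t t l`).  If all pivots `s t`,
`t.val < n - 1`, are nonzero, then for every such `t` and every `k > t`,
`s t * w^{(t+1)} k = w^{(t)} k`, where `w^{(m)}` is the rooted spanning tree
vector of `B m` on the vertex set `{v : m ≤ v.val}`. -/
theorem stmt_7 {S : Type*} [Semifield S] {n : ℕ} (hn : 2 ≤ n)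
    (a : Fin n → Fin n → S)
    (B : ℕ → Fin n → Fin n → S) (s : Fin n → S)
    (hB0 : ∀ k l : Fin n, B 0 k l = a k l)
    (hs : ∀ t : Fin n, s t = ∑ l ∈ Finset.univ.filter (fun l : Fin n => t < l), B t.val t l)
    (hB : ∀ t k l : Fin n, t < k → t < l →
      B (t.val + 1) k l = B t.val k l + B t.val k t * (s t)⁻¹ * B t.val t l)
    (hsne : ∀ t : Fin n, t.val < n - 1 → s t ≠ 0) :
    ∀ t : Fin n, t.val < n - 1 → ∀ k : Fin n, t < k →
      s t * rstVec (Finset.univ.filter (fun v : Fin n => t < v)) (B (t.val + 1)) k =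
        rstVec (Finset.univ.filter (fun v : Fin n => t ≤ v)) (B t.val) k := by
  intro t htn k htk
  have hV : Finset.univ.filter (fun v : Fin n => t < v) =
      (Finset.univ.filter (fun v : Fin n => t ≤ v)).erase t := by
    ext v
    simp [lt_iff_le_and_ne, and_comm, eq_comm]
  rw [hV]
  refine mul_rstVec_erase (by simp) htk.ne _ _ ?_ (hsne t htn) ?_
  · rw [hs t, hV]
  · rw [← hV]
    intro j hj l hl
    exact hB t j l (Finset.mem_filter.1 hj).2 (Finset.mem_filter.1 hl).2
end

section
/- Let S be a commutative semiring, let n ≥ 2, and let x_1, …, x_n ∈ S. Then Cayley's tree enumerator identity holds: (x_1 + x_2 + ⋯ + x_n)^{n-2} · x_n = Σ_{f an n-tree on {1,…,n}} x_1^{indeg(1,f)} · x_2^{indeg(2,f)} · ⋯ · x_n^{indeg(n,f)}. -/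
open Finset Classical in
/-- Parent functions of forests with root set `R` and non-root vertices `U`; they are extended by the
identity outside `U`. -/
noncomputable def rootedForests {V : Type*} [Fintype V] (R U : Finset V) : Finset (V → V) :=
  univ.filter fun f => (∀ j, j ∉ U → f j = j) ∧ ∀ j ∈ U, ∃ m : ℕ, f^[m] j ∈ R

open Finset in
theorem sum_powerset_pow_mul_sum {V S : Type*} [DecidableEq V] [CommSemiring S]
    (x : V → S) (a : S) {U : Finset V} (hU : U.Nonempty) :
    ∑ T ∈ U.powerset, a ^ #T *
        (if U \ T = ∅ then 1 else (∑ v ∈ T, x v) * (∑ v ∈ U, x v) ^ (#(U \ T) - 1)) =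
      a * (a + ∑ v ∈ U, x v) ^ (#U - 1) := by
  set X := ∑ v ∈ U, x v with hX
  obtain ⟨d, hd⟩ : ∃ d, #U = d + 1 := ⟨#U - 1, by have := hU.card_pos; omega⟩
  let g : ℕ → S := fun t => if t < d then a ^ (t + 1) * X ^ (d - 1 - t) else 0
  have hcoef : ∀ v ∈ U, (∑ T ∈ U.powerset with v ∈ T, g (#T - 1)) =
      ∑ m ∈ range (d + 1), d.choose m • g m := by
    intro v hv
    have hc : #(U.erase v) = d := by rw [card_erase_of_mem hv, hd]; rfl
    rw [← hc, ← sum_powerset_apply_card]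
    refine sum_bij' (fun T _ => T.erase v) (fun T _ => insert v T) ?_ ?_ ?_ ?_ ?_
    · intro T hT
      rw [mem_filter, mem_powerset] at hT
      exact mem_powerset.2 (erase_subset_erase v hT.1)
    · intro T hT
      rw [mem_powerset] at hT
      rw [mem_filter, mem_powerset]
      exact ⟨insert_subset hv (hT.trans (erase_subset v U)), mem_insert_self v T⟩
    · intro T hT
      exact insert_erase (mem_filter.1 hT).2
    · intro T hT
      exact erase_insert fun h => by simpa using mem_powerset.1 hT h
    · intro T hT
      rw [card_erase_of_mem (mem_filter.1 hT).2]
  have hterm : ∀ T ∈ U.powerset, a ^ #T *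
      (if U \ T = ∅ then 1 else (∑ v ∈ T, x v) * X ^ (#(U \ T) - 1)) =
      (∑ v ∈ T, x v * g (#T - 1)) + if T = U then a ^ (d + 1) else 0 := by
    intro T hT
    rw [mem_powerset] at hT
    rw [← sum_mul]
    by_cases hTU : T = U
    · subst hTU
      simp [g, hd]
    · have hne : U \ T ≠ ∅ := fun h => hTU (hT.antisymm (sdiff_eq_empty_iff_subset.1 h))
      have hlt : #T < #U := card_lt_card (hT.ssubset_of_ne hTU)
      rw [if_neg hne, if_neg hTU, card_sdiff_of_subset hT, add_zero]
      rcases T.eq_empty_or_nonempty with rfl | hTn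
      · simp
      · have hpos := hTn.card_pos
        have h1 : #T - 1 < d := by omega
        have h2 : #T - 1 + 1 = #T := by omega
        have h3 : d - 1 - (#T - 1) = #U - #T - 1 := by omega
        simp only [g, if_pos h1, h2, h3]
        ring
  rw [sum_congr rfl hterm, sum_add_distrib, sum_ite_eq' U.powerset U,
    if_pos (mem_powerset_self U),
    sum_comm' (t' := U) (s' := fun v => {T ∈ U.powerset | v ∈ T}) (by
      intro T v
      rw [mem_filter, mem_powerset]
      exact ⟨fun h => ⟨h, h.1 h.2⟩, fun h => h.1⟩)]
  simp only [← mul_sum]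
  rw [sum_congr rfl fun v hv => by rw [hcoef v hv], ← sum_mul, ← hX, hd, Nat.add_sub_cancel,
    add_pow, sum_range_succ, sum_range_succ, mul_add, mul_add, mul_sum, mul_sum]
  have hg : X * (d.choose d • g d) = 0 := by simp [g]
  rw [hg, add_zero]
  congr 1
  · refine sum_congr rfl fun m hm => ?_
    rw [mem_range] at hm
    have h1 : d - m = d - 1 - m + 1 := by omega
    simp only [g, if_pos hm, h1, nsmul_eq_mul]
    ring
  · simp [pow_succ']

section RootedForests

open Finset

variable {V S : Type*}

/-- Vertices reaching `R` under `f` reach the set `T` of vertices sent to `R`, already under any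
map `h` that agrees with `f` off `T`. -/
theorem exists_iterate_mem_children {R U T : Finset V} {f h : V → V} (hRU : Disjoint R U)
    (hf : ∀ j, j ∉ U → f j = j) (hT : ∀ j ∈ U, f j ∈ R → j ∈ T)
    (hh : ∀ j, j ∉ T → h j = f j) (m : ℕ) (j : V) (hj : j ∈ U) (hm : f^[m] j ∈ R) :
    ∃ k : ℕ, h^[k] j ∈ T := by
  induction m generalizing j with
  | zero => exact (disjoint_left.mp hRU hm hj).elim
  | succ m ih =>
    by_cases hjT : j ∈ T
    · exact ⟨0, hjT⟩
    have hjR : f j ∉ R := fun h' => hjT (hT j hj h')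
    rw [Function.iterate_succ_apply] at hm
    have hfU : f j ∈ U := by
      by_contra hn
      rw [Function.iterate_fixed (hf _ hn)] at hm
      exact hjR hm
    obtain ⟨k, hk⟩ := ih (f j) hfU hm
    exact ⟨k + 1, by rwa [Function.iterate_succ_apply, hh j hjT]⟩

theorem exists_iterate_mem_of_children {R T : Finset V} {f h : V → V}
    (hT : ∀ j ∈ T, f j ∈ R) (hh : ∀ j, j ∉ T → h j = f j) (m : ℕ) (j : V)
    (hm : h^[m] j ∈ T) : ∃ k : ℕ, f^[k] j ∈ R := by
  induction m generalizing j with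
  | zero => exact ⟨1, hT j hm⟩
  | succ m ih =>
    by_cases hjT : j ∈ T
    · exact ⟨1, hT j hjT⟩
    rw [Function.iterate_succ_apply] at hm
    obtain ⟨k, hk⟩ := ih _ hm
    exact ⟨k + 1, by rwa [Function.iterate_succ_apply, ← hh j hjT]⟩

variable [Fintype V]

theorem mem_rootedForests {R U : Finset V} {f : V → V} :
    f ∈ rootedForests R U ↔
      (∀ j, j ∉ U → f j = j) ∧ ∀ j ∈ U, ∃ m : ℕ, f^[m] j ∈ R := by
  simp [rootedForests]

theorem rootedForests_empty_right (R : Finset V) : rootedForests R ∅ = {id} := by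
  ext f
  simp [mem_rootedForests, funext_iff]

theorem rootedForests_empty_left {U : Finset V} (hU : U.Nonempty) :
    rootedForests ∅ U = ∅ := by
  obtain ⟨u, hu⟩ := hU
  ext f
  simp only [mem_rootedForests, notMem_empty, exists_false, iff_false, not_and]
  exact fun _ h => h u hu

variable [DecidableEq V] [CommSemiring S]

/-- The forests in which `T` is the set of children of roots. -/
theorem sum_rootedForests_children_eq (x : V → S) {R U T : Finset V} (hRU : Disjoint R U)
    (hTU : T ⊆ U) :
    ∑ f ∈ rootedForests R U with {j ∈ U | f j ∈ R} = T, ∏ j ∈ U, x (f j) =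
      (∑ r ∈ R, x r) ^ #T * ∑ h ∈ rootedForests T (U \ T), ∏ j ∈ U \ T, x (h j) := by
  have hpow : (∑ r ∈ R, x r) ^ #T =
      ∑ p ∈ Fintype.piFinset (fun v => if v ∈ T then R else {v}), ∏ j ∈ T, x (p j) := by
    have := prod_univ_sum (fun v => if v ∈ T then R else {v})
      (fun v w => if v ∈ T then x w else 1)
    have h2 : ∀ v : V, (∑ w ∈ (if v ∈ T then R else {v}), if v ∈ T then x w else 1) =
        if v ∈ T then ∑ r ∈ R, x r else 1 := by
      intro v; by_cases hv : v ∈ T <;> simp [hv]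
    simp only [h2] at this
    simpa [prod_ite_mem] using this
  rw [hpow, sum_mul_sum, ← sum_product']
  refine sum_bij' (fun f _ => (fun v => if v ∈ T then f v else v, fun v => if v ∈ T then v else f v))
    (fun q _ v => if v ∈ T then q.1 v else q.2 v) ?_ ?_ ?_ ?_ ?_
  · intro f hf
    rw [mem_filter, mem_rootedForests] at hf
    obtain ⟨⟨hfix, hreach⟩, hT⟩ := hf
    have hT' : ∀ j, j ∈ T ↔ j ∈ U ∧ f j ∈ R := by intro j; rw [← hT, mem_filter]
    rw [mem_product, Fintype.mem_piFinset, mem_rootedForests]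
    refine ⟨fun v => ?_, fun j hj => ?_, fun j hj => ?_⟩
    · by_cases hv : v ∈ T
      · simpa [hv] using ((hT' v).1 hv).2
      · simp [hv]
    · by_cases hv : j ∈ T
      · simp [hv]
      · simpa [hv] using hfix j (by simpa [hv] using hj)
    · obtain ⟨m, hm⟩ := hreach j (mem_sdiff.1 hj).1
      exact exists_iterate_mem_children hRU hfix (fun j h1 h2 => (hT' j).2 ⟨h1, h2⟩)
        (fun j hj => by simp [hj]) m j (mem_sdiff.1 hj).1 hm
  · rintro ⟨p, h⟩ hq
    rw [mem_product, Fintype.mem_piFinset, mem_rootedForests] at hq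
    obtain ⟨hp, hfix, hreach⟩ := hq
    dsimp only at hp hfix hreach ⊢
    have hpT : ∀ j ∈ T, p j ∈ R := fun j hj => by simpa [hj] using hp j
    rw [mem_filter, mem_rootedForests]
    refine ⟨⟨fun j hj => ?_, fun j hj => ?_⟩, ?_⟩
    · have hjT : j ∉ T := fun h' => hj (hTU h')
      simpa [hjT] using hfix j (by simp [hj])
    · have : ∃ m, h^[m] j ∈ T := by
        by_cases hjT : j ∈ T
        · exact ⟨0, hjT⟩
        · exact hreach j (mem_sdiff.2 ⟨hj, hjT⟩)
      obtain ⟨m, hm⟩ := this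
      exact exists_iterate_mem_of_children (h := h) (fun j hj => by simpa [hj] using hpT j hj)
        (fun j hj => by simp [hj]) m j hm
    · ext j
      rw [mem_filter]
      by_cases hjT : j ∈ T
      · simp [hjT, hTU hjT, hpT j hjT]
      · simp only [hjT, if_false, iff_false, not_and]
        intro hjU hjR
        obtain ⟨m, hm⟩ := hreach j (mem_sdiff.2 ⟨hjU, hjT⟩)
        have hnU : h j ∉ U := disjoint_left.mp hRU hjR
        cases m with
        | zero => exact hjT hm
        | succ m =>
          rw [Function.iterate_succ_apply,
            Function.iterate_fixed (hfix _ (by simp [hnU]))] at hm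
          exact hnU (hTU hm)
  · intro f _
    funext v
    by_cases hv : v ∈ T <;> simp [hv]
  · rintro ⟨p, h⟩ hq
    rw [mem_product, Fintype.mem_piFinset, mem_rootedForests] at hq
    obtain ⟨hp, hfix, -⟩ := hq
    refine Prod.ext (funext fun v => ?_) (funext fun v => ?_)
    · by_cases hv : v ∈ T
      · simp [hv]
      · simpa [hv, eq_comm] using hp v
    · by_cases hv : v ∈ T
      · simpa [hv, eq_comm] using hfix v (by simp [hv])
      · simp [hv]
  · intro f _
    dsimp only
    rw [← prod_sdiff hTU, mul_comm]
    congr 1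
    · exact prod_congr rfl fun j hj => by simp [hj]
    · exact prod_congr rfl fun j hj => by simp [(mem_sdiff.1 hj).2]

/-- The enumerator of rooted forests by indegrees. -/
theorem sum_rootedForests (x : V → S) (R U : Finset V) (hRU : Disjoint R U) :
    ∑ f ∈ rootedForests R U, ∏ j ∈ U, x (f j) =
      if U = ∅ then 1 else
        (∑ v ∈ R, x v) * (∑ v ∈ R, x v + ∑ v ∈ U, x v) ^ (#U - 1) := by
  induction U using Finset.strongInduction generalizing R with
  | H U ih =>
    rcases U.eq_empty_or_nonempty with rfl | hU
    · simp [rootedForests_empty_right]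
    rw [if_neg hU.ne_empty, ← sum_powerset_pow_mul_sum x _ hU,
      ← sum_fiberwise_of_maps_to (t := U.powerset) (g := fun f => {j ∈ U | f j ∈ R})
        (fun f _ => mem_powerset.2 (filter_subset _ _))]
    refine sum_congr rfl fun T hT => ?_
    rw [mem_powerset] at hT
    rw [sum_rootedForests_children_eq x hRU hT]
    congr 1
    rcases T.eq_empty_or_nonempty with rfl | hTn
    · simp [rootedForests_empty_left hU, hU.ne_empty]
    · rw [ih (U \ T) (sdiff_ssubset hT hTn) T disjoint_sdiff, add_comm (∑ v ∈ T, x v),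
        sum_sdiff hT]

end RootedForests

open scoped Classical

/-- **Cayley's tree enumerator identity in a commutative semiring.**  Vertices
are `Fin n` (vertex `i` stands for `i+1`; the root is the last vertex
`⟨n-1,_⟩`, standing for `n`).  An `n`-tree is encoded by `f : Fin n → Fin n`
fixing the root, with every vertex reaching the root under iteration; the
indegree of `i` is the number of `j ≠ root` with `f j = i`.  Then
`(x_1 + ⋯ + x_n)^(n-2) * x_n = ∑_{trees f} ∏_i x_i ^ indeg(i, f)`. -/
theorem stmt_10 {S : Type*} [CommSemiring S] {n : ℕ} (hn : 2 ≤ n)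
    (x : Fin n → S) :
    (∑ i : Fin n, x i) ^ (n - 2) * x ⟨n - 1, by omega⟩ =
      ∑ f ∈ Finset.univ.filter (fun f : Fin n → Fin n =>
          f ⟨n - 1, by omega⟩ = ⟨n - 1, by omega⟩ ∧
            ∀ j : Fin n, ∃ m : ℕ, f^[m] j = ⟨n - 1, by omega⟩),
        ∏ i : Fin n, x i ^
          (Finset.univ.filter
            (fun j : Fin n => j ≠ ⟨n - 1, by omega⟩ ∧ f j = i)).card := by
  set r : Fin n := ⟨n - 1, by omega⟩ with hr
  have hU : (Finset.univ.erase r).card = n - 1 := by simp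
  have hne : Finset.univ.erase r ≠ ∅ := by
    rw [Ne, ← Finset.card_eq_zero, hU]
    omega
  have key := sum_rootedForests x {r} (Finset.univ.erase r) (by simp)
  rw [if_neg hne, Finset.sum_singleton, Finset.add_sum_erase _ _ (Finset.mem_univ r), hU,
    Nat.sub_sub] at key
  rw [mul_comm, ← key]
  refine Finset.sum_congr ?_ fun f _ => ?_
  · ext f
    rw [mem_rootedForests, Finset.mem_filter]
    simp only [Finset.mem_erase, Finset.mem_univ, and_true, true_and, not_not, forall_eq,
      Finset.mem_singleton]
    refine and_congr_right fun _ => ⟨fun h j => ?_, fun h j _ => h j⟩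
    by_cases hj : j = r
    · exact ⟨0, hj⟩
    · exact h j hj
  · rw [← Finset.prod_fiberwise_of_maps_to (t := Finset.univ) (g := f)
      (fun _ _ => Finset.mem_univ _)]
    refine Finset.prod_congr rfl fun i _ => ?_
    rw [Finset.prod_congr rfl fun j hj => by rw [(Finset.mem_filter.1 hj).2],
      Finset.prod_const]
    congr 2
    ext j
    simp
end

section
/- Let S be a commutative semiring, let n ≥ 2, and let x_2, …, x_n ∈ S. Then (x_2 + ⋯ + x_n)^{n-2} · x_n = Σ_{f an n-tree on {1,…,n} with indeg(1,f) = 0} x_2^{indeg(2,f)} · ⋯ · x_n^{indeg(n,f)}, where the sum is over all n-trees on {1,…,n} in which vertex 1 is a leaf (has no incoming edges). -/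
open scoped Classical

/-- The value at `b` of the map `Fin (m + 2) → Fin (m + 1)` that merges vertex `0` into `v`. -/
def mergeZero {m : ℕ} (v : Fin (m + 1)) (b : Fin (m + 2)) : Fin (m + 1) :=
  Fin.cases v id b

/-- Every vertex reaches the last one under iteration of `f`. -/
def ReachesLast {m : ℕ} (f : Fin (m + 1) → Fin (m + 1)) : Prop :=
  ∀ j, ∃ k : ℕ, f^[k] j = Fin.last m

/-- The contribution of the edge `(j, b)`; the last vertex has to be fixed. -/
def edgeWeight {S : Type*} [CommSemiring S] {m : ℕ} (x : Fin (m + 1) → S)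
    (j b : Fin (m + 1)) : S :=
  if j = Fin.last m then (if b = Fin.last m then 1 else 0) else x b

/-- The weighted count of trees on `Fin (m + 1)` rooted at the last vertex. -/
noncomputable def treeSum {S : Type*} [CommSemiring S] {m : ℕ} (x : Fin (m + 1) → S) : S :=
  ∑ f : Fin (m + 1) → Fin (m + 1), if ReachesLast f then ∏ j, edgeWeight x j (f j) else 0

@[simp]
theorem mergeZero_zero {m : ℕ} (v : Fin (m + 1)) : mergeZero v 0 = v := rfl

@[simp]
theorem mergeZero_succ {m : ℕ} (v i : Fin (m + 1)) : mergeZero v i.succ = i := rfl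

theorem not_reachesLast_cons_zero {m : ℕ} (h : Fin (m + 1) → Fin (m + 2)) :
    ¬ ReachesLast (Fin.cons 0 h : Fin (m + 2) → Fin (m + 2)) := by
  intro hf
  obtain ⟨k, hk⟩ := hf 0
  rw [Function.iterate_fixed (by simp)] at hk
  exact Fin.last_pos.ne hk

theorem reachesLast_cons_succ_iff {m : ℕ} (v : Fin (m + 1)) (h : Fin (m + 1) → Fin (m + 2)) :
    ReachesLast (Fin.cons v.succ h : Fin (m + 2) → Fin (m + 2)) ↔
      ReachesLast (mergeZero v ∘ h) := by
  set f : Fin (m + 2) → Fin (m + 2) := Fin.cons v.succ h with hf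
  set g := mergeZero v ∘ h with hg
  have f_zero : f 0 = v.succ := rfl
  have f_succ (j) : f j.succ = h j := rfl
  constructor
  · have key (k : ℕ) : ∀ b, f^[k] b = Fin.last (m + 1) →
        ∃ l : ℕ, g^[l] (mergeZero v b) = Fin.last m := by
      induction k with
      | zero =>
        rintro b rfl
        exact ⟨0, rfl⟩
      | succ k ih =>
        intro b hb
        obtain ⟨l, hl⟩ := ih (f b) hb
        cases b using Fin.cases with
        | zero => exact ⟨l, hl⟩
        | succ j => exact ⟨l + 1, hl⟩
    intro hF j
    obtain ⟨k, hk⟩ := hF j.succ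
    exact key k _ hk
  · have key (k : ℕ) : ∀ j, g^[k] j = Fin.last m →
        ∃ l : ℕ, f^[l] j.succ = Fin.last (m + 1) := by
      induction k with
      | zero =>
        rintro j rfl
        exact ⟨0, rfl⟩
      | succ k ih =>
        intro j hj
        obtain ⟨l, hl⟩ := ih (g j) hj
        obtain hb | ⟨i, hb⟩ := Fin.eq_zero_or_eq_succ (h j)
        · refine ⟨l + 2, ?_⟩
          rw [Function.iterate_add_apply]
          simpa [f_succ, f_zero, hb, hg] using hl
        · refine ⟨l + 1, ?_⟩
          rw [Function.iterate_add_apply]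
          simpa [f_succ, hb, hg] using hl
    intro hG b
    cases b using Fin.cases with
    | zero =>
      obtain ⟨k, hk⟩ := hG v
      obtain ⟨l, hl⟩ := key k v hk
      exact ⟨l + 1, hl⟩
    | succ j =>
      obtain ⟨k, hk⟩ := hG j
      exact key k j hk

theorem sum_edgeWeight_fiber {S : Type*} [CommSemiring S] {m : ℕ} (x : Fin (m + 2) → S)
    (v j i : Fin (m + 1)) :
    ∑ b with mergeZero v b = i, edgeWeight x j.succ b =
      edgeWeight (fun i => x i.succ + if i = v then x 0 else 0) j i := by
  rw [Finset.sum_filter, Fin.sum_univ_succ]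
  have hlast (k : Fin (m + 1)) : k.succ = Fin.last (m + 1) ↔ k = Fin.last m := by
    rw [← Fin.succ_last, Fin.succ_inj]
  have hzero : (0 : Fin (m + 2)) ≠ Fin.last (m + 1) := Fin.last_pos.ne
  by_cases hj : j = Fin.last m
  · simp [edgeWeight, hlast, hj, hzero]
  · simp [edgeWeight, hlast, hj, eq_comm (a := v), add_comm]

/-- Contraction of the edge leaving vertex `0`. -/
theorem treeSum_succ {S : Type*} [CommSemiring S] {m : ℕ} (x : Fin (m + 2) → S) :
    treeSum x = ∑ v : Fin (m + 1), x v.succ *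
      treeSum (fun i => x i.succ + if i = v then x 0 else 0) := by
  have hzero : (0 : Fin (m + 2)) ≠ Fin.last (m + 1) := Fin.last_pos.ne
  rw [treeSum, ← (Fin.consEquiv fun _ => Fin (m + 2)).sum_comp, Fintype.sum_prod_type,
    Fin.sum_univ_succ]
  refine (congrArg₂ (· + ·) (Finset.sum_eq_zero fun h _ =>
    if_neg (not_reachesLast_cons_zero h)) rfl).trans ?_
  rw [zero_add]
  refine Finset.sum_congr rfl fun v _ => ?_
  have hcons (h : Fin (m + 1) → Fin (m + 2)) :
      (if ReachesLast (Fin.cons v.succ h : Fin (m + 2) → Fin (m + 2)) then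
        ∏ j, edgeWeight x j ((Fin.cons v.succ h : Fin (m + 2) → Fin (m + 2)) j) else 0) =
      if ReachesLast (mergeZero v ∘ h) then
        x v.succ * ∏ j : Fin (m + 1), edgeWeight x j.succ (h j) else 0 := by
    rw [Fin.prod_univ_succ]
    simp [reachesLast_cons_succ_iff, edgeWeight, hzero]
  refine (Finset.sum_congr rfl fun h _ => hcons h).trans ?_
  rw [treeSum, Finset.mul_sum,
    ← Finset.sum_fiberwise Finset.univ fun h : Fin (m + 1) → Fin (m + 2) => mergeZero v ∘ h]
  refine Finset.sum_congr rfl fun g _ => ?_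
  simp only [← sum_edgeWeight_fiber, Finset.prod_univ_sum]
  have hfiber : (Finset.univ.filter fun h : Fin (m + 1) → Fin (m + 2) => mergeZero v ∘ h = g) =
      Fintype.piFinset fun j => Finset.univ.filter fun b => mergeZero v b = g j := by
    ext h
    simp [funext_iff]
  rw [← hfiber]
  calc
    _ = ∑ h : Fin (m + 1) → Fin (m + 2) with mergeZero v ∘ h = g,
        if ReachesLast g then x v.succ * ∏ j : Fin (m + 1), edgeWeight x j.succ (h j) else 0 :=
      Finset.sum_congr rfl fun h hh => by rw [(Finset.mem_filter.mp hh).2]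
    _ = _ := by split_ifs <;> simp [Finset.mul_sum]

theorem sum_mul_treeSum {S : Type*} [CommSemiring S] {m : ℕ} (x : Fin (m + 1) → S) :
    (∑ i, x i) * treeSum x = (∑ i, x i) ^ m * x (Fin.last m) := by
  induction m with
  | zero =>
    have (f : Fin 1 → Fin 1) : ReachesLast f := fun j => ⟨0, Subsingleton.elim (α := Fin 1) _ _⟩
    simp [treeSum, edgeWeight, this, Finset.filter_singleton]
  | succ m ih =>
    have hsum (v : Fin (m + 1)) :
        ∑ i : Fin (m + 1), (x i.succ + if i = v then x 0 else 0) = ∑ i, x i := by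
      rw [Finset.sum_add_distrib, Fin.sum_univ_succ x]
      simp [add_comm]
    have hstep (v : Fin (m + 1)) := ih fun i => x i.succ + if i = v then x 0 else 0
    simp only [hsum] at hstep
    rw [treeSum_succ, Finset.mul_sum]
    simp only [mul_left_comm _ (x _), hstep]
    simp only [mul_add, Finset.sum_add_distrib, ← Finset.sum_mul, mul_ite, mul_zero,
      Finset.sum_ite_eq, Finset.mem_univ, if_true, Fin.succ_last]
    rw [pow_succ, Fin.sum_univ_succ x]
    ring

theorem treeSum_cons_zero {S : Type*} [CommSemiring S] {m : ℕ} (x : Fin (m + 1) → S) :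
    treeSum (Fin.cons 0 x : Fin (m + 2) → S) = (∑ i, x i) ^ m * x (Fin.last m) := by
  simp [treeSum_succ, ← Finset.sum_mul, sum_mul_treeSum]

/-- **Cayley enumerator over trees in which vertex `1` is a leaf.**  Vertices
are `Fin n` (vertex `0` stands for `1`; the root is the last vertex, standing
for `n`).  An `n`-tree is encoded by `f : Fin n → Fin n` fixing the root, with
every vertex reaching the root under iteration; the indegree of `i` is the
number of `j ≠ root` with `f j = i`; vertex `0` is a leaf when its indegree is
`0`.  Then `(x_2 + ⋯ + x_n)^(n-2) * x_n` equals the sum over all `n`-trees in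
which vertex `0` is a leaf of `∏_{i ≠ 0} x_i ^ indeg(i, f)`. -/
theorem stmt_11 {S : Type*} [CommSemiring S] {n : ℕ} [NeZero n] (hn : 2 ≤ n)
    (x : Fin n → S) :
    (∑ i ∈ Finset.univ.filter (fun i : Fin n => i ≠ 0), x i) ^ (n - 2) *
        x ⟨n - 1, by omega⟩ =
      ∑ f ∈ Finset.univ.filter (fun f : Fin n → Fin n =>
          f ⟨n - 1, by omega⟩ = ⟨n - 1, by omega⟩ ∧
            (∀ j : Fin n, ∃ m : ℕ, f^[m] j = ⟨n - 1, by omega⟩) ∧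
            (Finset.univ.filter
              (fun j : Fin n => j ≠ ⟨n - 1, by omega⟩ ∧ f j = 0)).card = 0),
        ∏ i ∈ Finset.univ.filter (fun i : Fin n => i ≠ 0), x i ^
          (Finset.univ.filter
            (fun j : Fin n => j ≠ ⟨n - 1, by omega⟩ ∧ f j = i)).card := by
  obtain ⟨m, rfl⟩ : ∃ m, n = m + 2 := ⟨n - 2, by omega⟩
  have hroot : (⟨m + 2 - 1, by omega⟩ : Fin (m + 2)) = Fin.last (m + 1) := rfl
  have hzero : (0 : Fin (m + 2)) ≠ Fin.last (m + 1) := Fin.last_pos.ne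
  simp only [hroot]
  have hs : ∑ i ∈ Finset.univ.filter (fun i : Fin (m + 2) => i ≠ 0), x i =
      ∑ i : Fin (m + 1), x i.succ := by
    rw [Finset.sum_filter, Fin.sum_univ_succ]
    simp
  rw [hs, Nat.add_sub_cancel, ← Fin.succ_last]
  rw [← treeSum_cons_zero fun i => x i.succ, treeSum, Finset.sum_filter, Fin.succ_last]
  refine Finset.sum_congr rfl fun f _ => ?_
  by_cases hlast : f (Fin.last (m + 1)) = Fin.last (m + 1)
  swap
  · rw [Fin.prod_univ_castSucc, if_neg (fun h => hlast h.1 : ¬ (_ ∧ _))]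
    simp [edgeWeight, hlast]
  by_cases hreach : ReachesLast f
  swap
  · rw [if_neg hreach, if_neg fun h => hreach h.2.1]
  have hprod : ∏ j, edgeWeight (Fin.cons 0 fun i => x i.succ) j (f j) =
      ∏ j with j ≠ Fin.last (m + 1), (Fin.cons 0 fun i => x i.succ : Fin (m + 2) → S) (f j) := by
    rw [Finset.prod_filter]
    refine Finset.prod_congr rfl fun j _ => ?_
    by_cases hj : j = Fin.last (m + 1)
    · simp [edgeWeight, hj, hlast]
    · simp [edgeWeight, hj]
  rw [if_pos hreach, hprod]
  split_ifs with h
  · have hne (j : Fin (m + 2)) (hj : j ≠ Fin.last (m + 1)) : f j ≠ 0 := fun h0 => by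
      have := Finset.card_eq_zero.mp h.2.2
      exact Finset.notMem_empty j (this ▸ Finset.mem_filter.mpr ⟨Finset.mem_univ j, hj, h0⟩)
    trans ∏ j with j ≠ Fin.last (m + 1), x (f j)
    · refine Finset.prod_congr rfl fun j hj => ?_
      obtain ⟨i, hi⟩ := Fin.exists_succ_eq.mpr (hne j (Finset.mem_filter.mp hj).2)
      rw [← hi, Fin.cons_succ]
    · rw [← Finset.prod_fiberwise_of_maps_to' (t := Finset.univ.filter fun i => i ≠ 0) (g := f)]
      · refine Finset.prod_congr rfl fun i _ => ?_
        rw [Finset.prod_const, Finset.filter_filter]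
      · exact fun j hj => Finset.mem_filter.mpr
          ⟨Finset.mem_univ _, hne j (Finset.mem_filter.mp hj).2⟩
  · have : ∃ j, j ≠ Fin.last (m + 1) ∧ f j = 0 := by
      by_contra! hne
      refine h ⟨hlast, hreach, Finset.card_eq_zero.mpr (Finset.filter_eq_empty_iff.mpr ?_)⟩
      exact fun j _ hj => hne j hj.1 hj.2
    obtain ⟨j, hj, hj0⟩ := this
    refine Finset.prod_eq_zero (i := j) (by simp [hj]) ?_
    rw [hj0]
    rfl
end

section
/- Let S be a commutative semiring, let n ≥ 2, and let x_2, …, x_n ∈ S. Then Σ_{f an n-tree on {1,…,n} with indeg(1,f)=0} x_2^{indeg(2,f)} · ⋯ · x_n^{indeg(n,f)} = (x_2 + ⋯ + x_n) · Σ_{g an n-tree on {2,…,n}} x_2^{indeg(2,g)} · ⋯ · x_n^{indeg(n,g)}; that is, summing the indegree monomials over all spanning trees rooted at n on the full vertex set {1,…,n} in which vertex 1 is a leaf equals (x_2 + ⋯ + x_n) times the corresponding sum over all spanning trees rooted at n on the vertex set {2,…,n}. -/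
open scoped Classical

section LeafRemoval

variable {V : Type*}

/-- If a function preserves the complement of `a`, its iterates there do not depend on
the value at `a`. -/
theorem iterate_eq_and_ne_of_eqOn_ne {f g : V → V} {a : V} (hfg : ∀ j, j ≠ a → f j = g j)
    (hg : ∀ j, j ≠ a → g j ≠ a) (m : ℕ) (j : V) (hj : j ≠ a) :
    f^[m] j = g^[m] j ∧ g^[m] j ≠ a := by
  induction m generalizing j with
  | zero => exact ⟨rfl, hj⟩
  | succ m ih =>
    simp only [Function.iterate_succ_apply, hfg j hj]
    exact ih (g j) (hg j hj)

/-- A map with no edge into `a` encodes an `r`-tree exactly when its restriction to the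
complement of `a` does. -/
theorem forall_exists_iterate_eq_iff_of_ne {f g : V → V} {a r : V}
    (hfg : ∀ j, j ≠ a → f j = g j) (hg : ∀ j, j ≠ a → g j ≠ a) (hfa : f a ≠ a) :
    (∀ j, ∃ m : ℕ, f^[m] j = r) ↔ ∀ j, j ≠ a → ∃ m : ℕ, g^[m] j = r := by
  have key := iterate_eq_and_ne_of_eqOn_ne hfg hg
  constructor
  · intro h j hj
    obtain ⟨m, hm⟩ := h j
    exact ⟨m, (key m j hj).1 ▸ hm⟩
  · intro h j
    by_cases hj : j = a
    · obtain ⟨m, hm⟩ := h (f a) hfa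
      refine ⟨m + 1, ?_⟩
      rw [hj, Function.iterate_succ_apply, (key m (f a) hfa).1, hm]
    · obtain ⟨m, hm⟩ := h j hj
      exact ⟨m, (key m j hj).1.trans hm⟩

/-- The product of `x i` to the number of edges into `i` is the product of `x` over the heads of
all edges. -/
theorem prod_pow_card_fiber_eq_prod {S : Type*} [CommSemiring S] [DecidableEq V]
    (x : V → S) (f : V → V) {s t : Finset V} (h : ∀ j ∈ s, f j ∈ t) :
    ∏ i ∈ t, x i ^ (s.filter (fun j => f j = i)).card = ∏ j ∈ s, x (f j) := by
  simp_rw [← Finset.prod_const]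
  exact Finset.prod_fiberwise_of_maps_to' h x

/-- Leaf removal for the indegree enumerator of `r`-trees on a finite vertex set. -/
theorem sum_prod_pow_indegree_of_leaf {S : Type*} [CommSemiring S] [Fintype V]
    [DecidableEq V] (x : V → S) {a r : V} (har : a ≠ r) :
    ∑ f ∈ Finset.univ.filter (fun f : V → V =>
        f r = r ∧ (∀ j, ∃ m : ℕ, f^[m] j = r) ∧
          (Finset.univ.filter (fun j => j ≠ r ∧ f j = a)).card = 0),
      ∏ i ∈ Finset.univ.filter (fun i => i ≠ a), x i ^
        (Finset.univ.filter (fun j => j ≠ r ∧ f j = i)).card =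
    (∑ i ∈ Finset.univ.filter (fun i => i ≠ a), x i) *
      ∑ g ∈ Finset.univ.filter (fun g : V → V =>
          g a = a ∧ (∀ j, j ≠ a → g j ≠ a) ∧ g r = r ∧
            ∀ j, j ≠ a → ∃ m : ℕ, g^[m] j = r),
        ∏ i ∈ Finset.univ.filter (fun i => i ≠ a), x i ^
          (Finset.univ.filter (fun j => j ≠ a ∧ j ≠ r ∧ g j = i)).card := by
  rw [Finset.sum_mul_sum, ← Finset.sum_product']
  have leaf_iff (f : V → V) : (Finset.univ.filter (fun j => j ≠ r ∧ f j = a)).card = 0 ↔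
      ∀ j, j ≠ r → f j ≠ a := by
    simp [Finset.filter_eq_empty_iff]
  refine Finset.sum_bij' (fun f _ => (f a, Function.update f a a))
    (fun p _ => Function.update p.2 a p.1) ?_ ?_ ?_ ?_ ?_
  · intro f hf
    simp only [Finset.mem_filter, Finset.mem_univ, true_and, leaf_iff] at hf
    obtain ⟨hr, ht, hl⟩ := hf
    have hne (j : V) : f j ≠ a := by
      by_cases hj : j = r
      · rw [hj, hr]; exact har.symm
      · exact hl j hj
    have hu : ∀ j, j ≠ a → f j = Function.update f a a j := fun j hj => by simp [hj]
    have hg : ∀ j, j ≠ a → Function.update f a a j ≠ a := fun j hj => hu j hj ▸ hne j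
    simp only [Finset.mem_product, Finset.mem_filter, Finset.mem_univ, true_and]
    exact ⟨hne a, Function.update_self .., hg, (hu r har.symm).symm.trans hr,
      (forall_exists_iterate_eq_iff_of_ne hu hg (hne a)).1 ht⟩
  · rintro ⟨i, g⟩ hp
    simp only [Finset.mem_product, Finset.mem_filter, Finset.mem_univ, true_and] at hp
    obtain ⟨hi, -, hg, hr, ht⟩ := hp
    have hu : ∀ j, j ≠ a → Function.update g a i j = g j := fun j hj => by simp [hj]
    simp only [Finset.mem_filter, Finset.mem_univ, true_and, leaf_iff]
    refine ⟨(hu r har.symm).trans hr,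
      (forall_exists_iterate_eq_iff_of_ne hu hg (by simpa using hi)).2 ht, fun j _ => ?_⟩
    by_cases hj : j = a
    · simpa [hj] using hi
    · rw [hu j hj]; exact hg j hj
  · intro f _
    simp
  · rintro ⟨i, g⟩ hp
    simp only [Finset.mem_product, Finset.mem_filter, Finset.mem_univ, true_and] at hp
    obtain ⟨-, hga, -⟩ := hp
    simp [hga]
  · intro f hf
    simp only [Finset.mem_filter, Finset.mem_univ, true_and, leaf_iff] at hf
    obtain ⟨-, -, hl⟩ := hf
    simp_rw [← and_assoc, ← Finset.filter_filter _ _ Finset.univ]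
    rw [prod_pow_card_fiber_eq_prod x f (by simpa using hl),
      prod_pow_card_fiber_eq_prod x (Function.update f a a)]
    · rw [← Finset.mul_prod_erase _ _ (Finset.mem_filter.2 ⟨Finset.mem_univ a, har⟩)]
      refine congrArg (x (f a) * ·) (Finset.prod_congr ?_ fun j hj => ?_)
      · ext j
        simp
      · simp only [Finset.mem_filter] at hj
        simp [hj.1.2]
    · intro j hj
      simp only [Finset.mem_filter, Finset.mem_univ, true_and] at hj ⊢
      simpa [hj.1] using hl j hj.2

end LeafRemoval

/-- **Leaf-removal identity for the Cayley enumerator.**  Vertices are `Fin n`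
(vertex `0` stands for `1`; the root is the last vertex, standing for `n`).
An `n`-tree on all vertices is encoded by `f : Fin n → Fin n` fixing the root,
with every vertex reaching the root; an `n`-tree on the vertex set `{v ≠ 0}` is
encoded by `g : Fin n → Fin n` with `g 0 = 0`, mapping `{v ≠ 0}` into itself,
fixing the root, and with every vertex `≠ 0` reaching the root.  Indegrees
count incoming edges from non-root vertices of the respective vertex set.
Summing the indegree monomials over all `n`-trees on `Fin n` in which vertex
`0` is a leaf equals `(x_2 + ⋯ + x_n)` times the corresponding sum over all
`n`-trees on `{v ≠ 0}`. -/
theorem stmt_12 {S : Type*} [CommSemiring S] {n : ℕ} [NeZero n] (hn : 2 ≤ n)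
    (x : Fin n → S) :
    ∑ f ∈ Finset.univ.filter (fun f : Fin n → Fin n =>
        f ⟨n - 1, by omega⟩ = ⟨n - 1, by omega⟩ ∧
          (∀ j : Fin n, ∃ m : ℕ, f^[m] j = ⟨n - 1, by omega⟩) ∧
          (Finset.univ.filter
            (fun j : Fin n => j ≠ ⟨n - 1, by omega⟩ ∧ f j = 0)).card = 0),
      ∏ i ∈ Finset.univ.filter (fun i : Fin n => i ≠ 0), x i ^
        (Finset.univ.filter
          (fun j : Fin n => j ≠ ⟨n - 1, by omega⟩ ∧ f j = i)).card =
    (∑ i ∈ Finset.univ.filter (fun i : Fin n => i ≠ 0), x i) *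
      ∑ g ∈ Finset.univ.filter (fun g : Fin n → Fin n =>
          g 0 = 0 ∧ (∀ j : Fin n, j ≠ 0 → g j ≠ 0) ∧
            g ⟨n - 1, by omega⟩ = ⟨n - 1, by omega⟩ ∧
            ∀ j : Fin n, j ≠ 0 → ∃ m : ℕ, g^[m] j = ⟨n - 1, by omega⟩),
        ∏ i ∈ Finset.univ.filter (fun i : Fin n => i ≠ 0), x i ^
          (Finset.univ.filter
            (fun j : Fin n => j ≠ 0 ∧ j ≠ ⟨n - 1, by omega⟩ ∧ g j = i)).card := by
  have h0 : (0 : Fin n) ≠ ⟨n - 1, by omega⟩ := by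
    intro h
    have := congrArg Fin.val h
    simp at this
    omega
  convert sum_prod_pow_indegree_of_leaf x h0
end
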